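/- Assume k < n+1 and let w ∈ W^odd ∩ W^P with w(1) = 1. Then ((w · O_Z(1)) W_P · O_Y(1)) W_P = ((w · O_Y(1)) W_P ·_k O^∘(1)) W_P; that is, the minimal length coset representatives of w · O_Z(1) · O_Y(1) and of w · O_Y(1) ·_k O^∘(1) in W/W_P coincide. -/

import Mathlib

/-!
Common framework: the Weyl group of type `C_{m+1}` realized as signed permutations
of `Fin (2*m+2)` (values 0-indexed: the paper's 1-indexed value `a ∈ {1, …, 2m+2}`
corresponds to `a-1`, and the paper's `bar a = 2m+3-a` corresponds to `2m+2-a`).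
For the odd symplectic Grassmannian `IG(k, 2n+1)` one takes `m = n`;
the smaller group `W_{2n}` of type `C_n` corresponds to `m = n-1`.
-/

namespace OddSymplectic

open Equiv

noncomputable section

/-- The element of `Fin (2*m+2)` with (0-indexed) value `i`. -/
def fn (m i : ℕ) : Fin (2*m+2) := ⟨i % (2*m+2), Nat.mod_lt _ (by omega)⟩

/-- The bar involution on values. -/
def bar (m : ℕ) (j : Fin (2*m+2)) : Fin (2*m+2) := ⟨2*m+1 - (j:ℕ), by omega⟩

def barPerm (m : ℕ) : Equiv.Perm (Fin (2*m+2)) :=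
  Function.Involutive.toPerm (bar m) (fun j => by
    have hj := j.isLt
    apply Fin.ext
    simp [bar]
    omega)

/-- The Weyl group of type `C_{m+1}`: the permutations of `Fin (2*m+2)` commuting with
the bar involution (signed permutations). -/
def Weyl (m : ℕ) : Subgroup (Equiv.Perm (Fin (2*m+2))) :=
  Subgroup.centralizer {barPerm m}

/-- The simple reflection `s_i`, `1 ≤ i ≤ m+1`. -/
def sRefl (m i : ℕ) : Equiv.Perm (Fin (2*m+2)) :=
  if i ≤ m then
    Equiv.swap (fn m (i-1)) (fn m i) * Equiv.swap (fn m (2*m+2-i)) (fn m (2*m+1-i))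
  else
    Equiv.swap (fn m m) (fn m (m+1))

/-- Coxeter length: the minimal length of an expression as a product of simple reflections. -/
def len (m : ℕ) (w : Equiv.Perm (Fin (2*m+2))) : ℕ :=
  sInf {r | ∃ l : List ℕ, l.length = r ∧ (∀ i ∈ l, 1 ≤ i ∧ i ≤ m+1) ∧
    (l.map (sRefl m)).prod = w}

/-- The set of reflections. -/
def reflections (m : ℕ) : Set (Equiv.Perm (Fin (2*m+2))) :=
  {t | ∃ u ∈ Weyl m, ∃ i, 1 ≤ i ∧ i ≤ m+1 ∧ t = u * sRefl m i * u⁻¹}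

/-- The Bruhat order. -/
def bruhatLE (m : ℕ) (u w : Equiv.Perm (Fin (2*m+2))) : Prop :=
  Relation.ReflTransGen (fun a b => ∃ t ∈ reflections m, b = a * t ∧ len m a < len m b) u w

/-- The parabolic subgroup `W_P` generated by the simple reflections `s_i`, `i ≠ kk`. -/
def WP (m kk : ℕ) : Subgroup (Equiv.Perm (Fin (2*m+2))) :=
  Subgroup.closure {x | ∃ i, 1 ≤ i ∧ i ≤ m+1 ∧ i ≠ kk ∧ x = sRefl m i}

/-- `x W_P = y W_P`. -/
def cosetEq (m kk : ℕ) (x y : Equiv.Perm (Fin (2*m+2))) : Prop := x⁻¹ * y ∈ WP m kk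

/-- `w ∈ W^P`: `w` is a minimal length representative of its coset `w W_P`. -/
def isMinRep (m kk : ℕ) (w : Equiv.Perm (Fin (2*m+2))) : Prop :=
  w ∈ Weyl m ∧ ∀ v ∈ WP m kk, len m w ≤ len m (w * v)

/-- `w ∈ W^{odd}`: `w(j) ≠ bar 1` for all `1 ≤ j ≤ m+1` (1-indexed positions). -/
def isOdd (m : ℕ) (w : Equiv.Perm (Fin (2*m+2))) : Prop :=
  ∀ j : Fin (2*m+2), (j:ℕ) ≤ m → w j ≠ fn m (2*m+1)

/-- `w ∈ W°`: odd symplectic permutations with `w(j) ≠ 1` for `1 ≤ j ≤ kk`. -/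
def isOpen (m kk : ℕ) (w : Equiv.Perm (Fin (2*m+2))) : Prop :=
  isOdd m w ∧ ∀ j : Fin (2*m+2), (j:ℕ) < kk → w j ≠ fn m 0

/-- `φ(u)`: the number of barred entries among the first `kk` values of `u`. -/
def phi (m kk : ℕ) (u : Equiv.Perm (Fin (2*m+2))) : ℕ :=
  (Finset.univ.filter (fun j : Fin (2*m+2) => (j:ℕ) < kk ∧ m+1 ≤ ((u j : ℕ)))).card

/-- The set of values of `w` on the first `kk` positions. -/
def valSet (m kk : ℕ) (w : Equiv.Perm (Fin (2*m+2))) : Finset (Fin (2*m+2)) :=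
  (Finset.univ.filter (fun j : Fin (2*m+2) => (j:ℕ) < kk)).image w

/-- The (1-indexed) absolute value `|x|` of a signed entry. -/
def absVal (m : ℕ) (x : Fin (2*m+2)) : ℕ :=
  if (x:ℕ) ≤ m then (x:ℕ)+1 else 2*m+2-(x:ℕ)

/-! ### Hecke products -/

def hStep (m : ℕ) (w : Equiv.Perm (Fin (2*m+2))) (i : ℕ) : Equiv.Perm (Fin (2*m+2)) :=
  if len m w < len m (w * sRefl m i) then w * sRefl m i else w

/-- Hecke product of `w` with the word `l` of simple reflections. -/
def hWord (m : ℕ) (w : Equiv.Perm (Fin (2*m+2))) (l : List ℕ) : Equiv.Perm (Fin (2*m+2)) :=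
  l.foldl (hStep m) w

def hStepK (m kk : ℕ) (w : Equiv.Perm (Fin (2*m+2))) (i : ℕ) : Equiv.Perm (Fin (2*m+2)) :=
  if len m w < len m (w * sRefl m i) ∨ i = kk then w * sRefl m i else w

/-- Modified Hecke product `·_k` of `w` with the word `l`. -/
def hWordK (m kk : ℕ) (w : Equiv.Perm (Fin (2*m+2))) (l : List ℕ) : Equiv.Perm (Fin (2*m+2)) :=
  l.foldl (hStepK m kk) w

/-- The list `[a, a+1, …, b]`. -/
def ascList (a b : ℕ) : List ℕ := List.range' a (b+1-a)

/-- The word `s_1 s_2 ⋯ s_{m+1} ⋯ s_2 s_1` for `O^∘(1)`. -/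
def wordOcirc1 (m : ℕ) : List ℕ := ascList 1 (m+1) ++ (ascList 1 m).reverse

/-- The word `s_1 ⋯ s_{kk-1} s_{kk+1} ⋯ s_{m+1} ⋯ s_2 s_1` for `O_Y(1)`. -/
def wordOY1 (m kk : ℕ) : List ℕ :=
  ascList 1 (kk-1) ++ ascList (kk+1) (m+1) ++ (ascList 1 m).reverse

/-- The word `s_2 ⋯ s_{m+1} ⋯ s_2` for `O_Z(1)`. -/
def wordOZ1 (m : ℕ) : List ℕ := ascList 2 (m+1) ++ (ascList 2 m).reverse

def wordOcirc (m d : ℕ) : List ℕ := (List.replicate d (wordOcirc1 m)).flatten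
def wordOZ (m d : ℕ) : List ℕ := (List.replicate d (wordOZ1 m)).flatten

/-- `w ·_k O^∘(d)`. -/
def mulOcirc (m kk : ℕ) (w : Equiv.Perm (Fin (2*m+2))) (d : ℕ) : Equiv.Perm (Fin (2*m+2)) :=
  hWordK m kk w (wordOcirc m d)

/-- `w · O_Z(d)`. -/
def mulOZ (m : ℕ) (w : Equiv.Perm (Fin (2*m+2))) (d : ℕ) : Equiv.Perm (Fin (2*m+2)) :=
  hWord m w (wordOZ m d)

/-- `w · O_Y(1)`. -/
def mulOY1 (m kk : ℕ) (w : Equiv.Perm (Fin (2*m+2))) : Equiv.Perm (Fin (2*m+2)) :=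
  hWord m w (wordOY1 m kk)

/-- `w · O_Y(d) = (w · O_Y(1)) ·_k O^∘(d-1)`. -/
def mulOY (m kk : ℕ) (w : Equiv.Perm (Fin (2*m+2))) (d : ℕ) : Equiv.Perm (Fin (2*m+2)) :=
  mulOcirc m kk (mulOY1 m kk w) (d-1)

/-! ### Positive roots of type `C_{m+1}` -/

/-- Positive roots of type `C_{m+1}` (1-indexed `i < j ≤ m+1`). -/
inductive PosRoot : Type
  | tm (i j : ℕ)   -- `t_i - t_j`
  | tp (i j : ℕ)   -- `t_i + t_j`
  | lg (i : ℕ)     -- `2 t_i`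

def PosRoot.valid (m : ℕ) : PosRoot → Prop
  | .tm i j => 1 ≤ i ∧ i < j ∧ j ≤ m+1
  | .tp i j => 1 ≤ i ∧ i < j ∧ j ≤ m+1
  | .lg i => 1 ≤ i ∧ i ≤ m+1

/-- The reflection `s_α`. -/
def PosRoot.refl (m : ℕ) : PosRoot → Equiv.Perm (Fin (2*m+2))
  | .tm i j => Equiv.swap (fn m (i-1)) (fn m (j-1)) *
      Equiv.swap (fn m (2*m+2-i)) (fn m (2*m+2-j))
  | .tp i j => Equiv.swap (fn m (i-1)) (fn m (2*m+2-j)) *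
      Equiv.swap (fn m (j-1)) (fn m (2*m+2-i))
  | .lg i => Equiv.swap (fn m (i-1)) (fn m (2*m+2-i))

/-- The coefficient of the simple root `α_kk` in the expansion of `α` in simple roots. -/
def PosRoot.rootCoeff (m kk : ℕ) : PosRoot → ℕ
  | .tm i j => if i ≤ kk ∧ kk < j then 1 else 0
  | .tp i j => if i ≤ kk ∧ kk < j then 1 else if j ≤ kk ∧ kk ≤ m then 2
      else if j ≤ kk then 1 else 0
  | .lg i => if i ≤ kk ∧ kk ≤ m then 2 else if i ≤ kk then 1 else 0

/-- The coefficient of the simple coroot `α_kk^∨` in the expansion of `α^∨` in simple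
coroots: the degree of the corresponding edge of the moment graph. -/
def PosRoot.corootCoeff (kk : ℕ) : PosRoot → ℕ
  | .tm i j => if i ≤ kk ∧ kk < j then 1 else 0
  | .tp i j => if i ≤ kk ∧ kk < j then 1 else if j ≤ kk then 2 else 0
  | .lg i => if i ≤ kk then 1 else 0

/-- `α ∈ R_1^+`. -/
def PosRoot.inR1 (m kk : ℕ) : PosRoot → Bool
  | .tm i j => decide (1 ≤ i ∧ i ≤ kk ∧ kk < j ∧ j ≤ m+1)
  | .tp i j => decide (1 ≤ i ∧ i ≤ kk ∧ kk < j ∧ j ≤ m+1)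
  | .lg i => decide (1 ≤ i ∧ i ≤ kk)

/-- `α ∈ R_2^+`. -/
def PosRoot.inR2 (kk : ℕ) : PosRoot → Bool
  | .tp i j => decide (1 ≤ i ∧ i < j ∧ j ≤ kk)
  | _ => false

/-- Chains in the moment graph of `IG(kk, 2m+2)`, recorded with their list of roots:
each step goes from the vertex `u W_P` to the vertex with minimal length representative
`v`, where `v W_P = u s_α W_P` and `α ∈ R^+ \ R_P^+`. -/
inductive Chain (m kk : ℕ) :
    Equiv.Perm (Fin (2*m+2)) → Equiv.Perm (Fin (2*m+2)) → List PosRoot → Prop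
  | nil (u : Equiv.Perm (Fin (2*m+2))) : Chain m kk u u []
  | cons {u w : Equiv.Perm (Fin (2*m+2))} {l : List PosRoot}
      (a : PosRoot) (v : Equiv.Perm (Fin (2*m+2))) :
      a.valid m → a.rootCoeff m kk ≠ 0 → isMinRep m kk v →
      cosetEq m kk v (u * a.refl m) → Chain m kk v w l → Chain m kk u w (a :: l)

/-- The degree of a chain: the sum of the degrees of its edges. -/
def chainDeg (kk : ℕ) (l : List PosRoot) : ℕ := (l.map (PosRoot.corootCoeff kk)).sum

/-- Chains of a given total degree in the moment graph of `IG(kk, 2m+1)`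
(the full subgraph of the moment graph of `IG(kk, 2m+2)` on `W^P ∩ W^{odd}`). -/
inductive ChainO (m kk : ℕ) :
    Equiv.Perm (Fin (2*m+2)) → Equiv.Perm (Fin (2*m+2)) → ℕ → Prop
  | nil (u : Equiv.Perm (Fin (2*m+2))) : ChainO m kk u u 0
  | cons {u w : Equiv.Perm (Fin (2*m+2))} {d : ℕ}
      (a : PosRoot) (v : Equiv.Perm (Fin (2*m+2))) :
      a.valid m → a.rootCoeff m kk ≠ 0 → isMinRep m kk v → isOdd m v →
      cosetEq m kk v (u * a.refl m) → ChainO m kk v w d →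
      ChainO m kk u w (a.corootCoeff kk + d)

/-! ### The maps `Φ`, `Φ_Z`, `ψ` -/

/-- The relation `Φ(w W_P) = w' W_Y`, for `w` in the type `C_{n+1}` group and `w'` in the
type `C_n` group (entrywise shift of the first `kk` values). -/
def PhiRel (n kk : ℕ) (w : Equiv.Perm (Fin (2*n+2)))
    (w' : Equiv.Perm (Fin (2*(n-1)+2))) : Prop :=
  ∀ j, j < kk → ((w' (fn (n-1) j) : ℕ) + 1 = (w (fn n j) : ℕ))

/-- The relation `Φ_Z(w W_P) = w' W_Z` (entrywise shift of the values in positions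
`2, …, kk`). -/
def PhiZRel (n kk : ℕ) (w : Equiv.Perm (Fin (2*n+2)))
    (w' : Equiv.Perm (Fin (2*(n-1)+2))) : Prop :=
  ∀ j, j + 1 < kk → ((w' (fn (n-1) j) : ℕ) + 1 = (w (fn n (j+1)) : ℕ))

/-- The word `ψ(s_i)`. -/
def psiWord (kk i : ℕ) : List ℕ :=
  if i ≤ kk-1 then [i] else if i = kk then [kk, kk+1, kk] else [i+1]

/-- `j ↦ min({2,…,m+1} \ {|w(p)|, …, |w(kk)|})` (1-indexed positions `p ≤ j ≤ kk`). -/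
def jmin (m kk p : ℕ) (w : Equiv.Perm (Fin (2*m+2))) : ℕ :=
  sInf {i | 2 ≤ i ∧ i ≤ m+1 ∧ ∀ j, p ≤ j → j ≤ kk → absVal m (w (fn m (j-1))) ≠ i}

/-! ### Partitions -/

/-- `μ ∈ Part(k, N)`, encoded as a function `ℕ → ℤ` supported on `{1, …, k}`. -/
def IsPart (k N : ℕ) (μ : ℕ → ℤ) : Prop :=
  (∀ j, 1 ≤ j → j < k → μ (j+1) ≤ μ j) ∧ μ 1 ≤ (N:ℤ) - k ∧
  (∀ j, 1 ≤ j → j ≤ k → 0 ≤ μ j) ∧ (∀ j, j = 0 ∨ k < j → μ j = 0)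

/-- `D(μ)(i)`: the `i`-th step of the boundary path of the Young diagram of `μ` inside
the `k × (N-k)` rectangle (from northeast to southwest) is vertical. -/
def Dword (k N : ℕ) (μ : ℕ → ℤ) (i : ℕ) : Prop :=
  ∃ j, 1 ≤ j ∧ j ≤ k ∧ (i:ℤ) = (N:ℤ) - k - μ j + j

/-- `μ ∈ BC(k, 2n+2)`. -/
def IsBCeven (n k : ℕ) (μ : ℕ → ℤ) : Prop :=
  IsPart k (2*n+2) μ ∧
  ∀ i, 1 ≤ i → i ≤ n+1 → ¬(Dword k (2*n+2) μ i ∧ Dword k (2*n+2) μ (2*n+3-i))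

/-- `λ + 1^k`. -/
def addOne (k : ℕ) (lam : ℕ → ℤ) (j : ℕ) : ℤ := if 1 ≤ j ∧ j ≤ k then lam j + 1 else 0

/-- `λ ∈ BC(k, 2n+1)`: `λ ∈ Part(k, 2n+1)` and `λ + 1^k ∈ BC(k, 2n+2)`. -/
def IsBCodd (n k : ℕ) (lam : ℕ → ℤ) : Prop :=
  IsPart k (2*n+1) lam ∧ IsBCeven n k (addOne k lam)

/-- `β ∈ BKT(k, 2n+2)`: `(n+1-k)`-strict partitions. -/
def IsBKTeven (n k : ℕ) (β : ℕ → ℤ) : Prop :=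
  IsPart k (2*n+2) β ∧ ∀ j, 1 ≤ j → j < k → ((n:ℤ)+1-k < β j → β (j+1) < β j)

/-- `α ∈ BKT(k, 2n+1)`: `α = β - 1^k` with `β ∈ BKT(k, 2n+2)`. -/
def IsBKTodd (n k : ℕ) (α : ℕ → ℤ) : Prop :=
  IsBKTeven n k (addOne k α) ∧ (∀ j, j = 0 ∨ k < j → α j = 0)

/-- `ℓ(λ)`: the number of nonzero parts. -/
def numParts (k : ℕ) (lam : ℕ → ℤ) : ℕ :=
  ((Finset.Icc 1 k).filter (fun j => lam j ≠ 0)).card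

/-- `ℓ_i^d(λ) = #{j > d : λ_j > i}`. -/
def elld (k : ℕ) (lam : ℕ → ℤ) (i : ℤ) (d : ℕ) : ℕ :=
  ((Finset.Icc 1 k).filter (fun j => d < j ∧ i < lam j)).card

/-- `λ^{O∘(1)} = (λ_2-1, …, λ_{ℓ(λ)}-1, 0, …, 0)`. -/
def Oc1 (k : ℕ) (lam : ℕ → ℤ) (j : ℕ) : ℤ :=
  if 1 ≤ j ∧ j + 1 ≤ numParts k lam then lam (j+1) - 1 else 0

/-- `λ^{O∘(d)}`. -/
def OcD (k : ℕ) (lam : ℕ → ℤ) : ℕ → ℕ → ℤ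
  | 0 => lam
  | d+1 => Oc1 k (OcD k lam d)

/-- `λ^{O_Z(1)} = (λ_1, λ_3-1, …, λ_{ℓ(λ)}-1, 0, …, 0)` for `λ ∈ BC(k, 2n+1)`. -/
def OZ1 (k : ℕ) (lam : ℕ → ℤ) (j : ℕ) : ℤ :=
  if j = 1 then lam 1
  else if 2 ≤ j ∧ j + 1 ≤ numParts k lam then lam (j+1) - 1
  else 0

/-- `λ^{O_Z(d)}`. -/
def OZd (k : ℕ) (lam : ℕ → ℤ) : ℕ → ℕ → ℤ
  | 0 => lam
  | d+1 => OZ1 k (OZd k lam d)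

/-- `Comp_BC(d)`. -/
def CompBC (n k d : ℕ) (lam : ℕ → ℤ) : Prop :=
  IsBCodd n k lam ∧ lam 1 = 2*(n:ℤ)+1-k ∧
  lam (d+1) - (elld k lam ((d:ℤ)-1) (d+1) : ℤ) - d = 2*((n:ℤ)+1-k)

/-- The transposed partition. -/
def transpose (k : ℕ) (μ : ℕ → ℤ) (j : ℕ) : ℤ :=
  if 1 ≤ j then (((Finset.Icc 1 k).filter (fun i => (j:ℤ) ≤ μ i)).card : ℤ) else 0

/-- `D(μ)(i) = D(μ^t)(i)`. -/
def wingAgree (n k : ℕ) (μ : ℕ → ℤ) (i : ℕ) : Prop :=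
  Dword k (2*n+2) μ i ↔ Dword (2*n+2-k) (2*n+2) (transpose k μ) i

/-- `μ ∈ Part(k, 2n+2)` is `m`-wingtip symmetric. -/
def isWingtipEven (n k : ℕ) (μ : ℕ → ℤ) (m : ℕ) : Prop :=
  (∀ i, 1 ≤ i → i ≤ m → wingAgree n k μ i) ∧ (m = 2*n+2 ∨ ¬ wingAgree n k μ (m+1))

/-- `λ ∈ BC(k, 2n+1)` is `m`-wingtip symmetric. -/
def isWingtip (n k : ℕ) (lam : ℕ → ℤ) (m : ℕ) : Prop :=
  isWingtipEven n k (addOne k lam) m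

open scoped Classical in
/-- `λ^{O_Y(1)}` for an `m`-wingtip symmetric `λ ∈ BC(k, 2n+1)` with `λ_1 = 2n+1-k`. -/
def OY1 (n k m : ℕ) (lam : ℕ → ℤ) : ℕ → ℤ :=
  -- the step of `D(λ)` at position `bar m = 2n+3-m`
  let s := 2*n+3-m
  -- the row at (or just above) the step at position `s`
  let i := ((Finset.Icc 1 s).filter (fun t => Dword k (2*n+2) (addOne k lam) t)).card
  -- the column of the step at position `s` (when horizontal)
  let j := (2*n+2-k) + 1 -
    ((Finset.Icc 1 s).filter (fun t => ¬ Dword k (2*n+2) (addOne k lam) t)).card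
  if Dword k (2*n+2) (addOne k lam) s then
    -- `D(λ)(bar m) = 1` is the `i`-th 1: `(λ_2-1, …, λ_{i-1}-1, λ_i, λ_i, λ_{i+1}, …, λ_k)`
    fun p =>
      if 1 ≤ p ∧ p + 2 ≤ i then lam (p+1) - 1
      else if (p = i - 1 ∨ p = i) ∧ 1 ≤ p ∧ p ≤ k then lam i
      else if i + 1 ≤ p ∧ p ≤ k then lam p
      else 0
  else
    -- horizontal step at the bottom of row `i`, column `j`:
    -- `(λ_2-1, …, λ_i-1, j, λ_{i+1}, …, λ_k)`
    fun p =>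
      if 1 ≤ p ∧ p + 1 ≤ i then lam (p+1) - 1
      else if p = i ∧ 1 ≤ p ∧ p ≤ k then (j:ℤ)
      else if i + 1 ≤ p ∧ p ≤ k then lam p
      else 0

/-- `λ^{O_Y(d)} = (λ^{O_Y(1)})^{O∘(d-1)}`. -/
def OYd (n k m : ℕ) (lam : ℕ → ℤ) (d : ℕ) : ℕ → ℤ := OcD k (OY1 n k m lam) (d-1)

open scoped Classical in
/-- `α^{O_Z(1)}` for `α ∈ BKT(k, 2n+1)` with `α_1 = 2n+1-k`. -/
def OZ1bkt (n k : ℕ) (α : ℕ → ℤ) : ℕ → ℤ :=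
  if ∃ j, 3 ≤ j ∧ j ≤ k ∧ α 2 + α j ≤ 2*((n:ℤ)-k)+j-2 then
    -- `j0` minimal such that `α_2 + α_{j0} ≤ 2(n-k)+j0-2`
    let j0 := sInf {j | 3 ≤ j ∧ j ≤ k ∧ α 2 + α j ≤ 2*((n:ℤ)-k)+j-2}
    fun p =>
      if p = 1 then α 1
      else if 2 ≤ p ∧ p + 2 ≤ j0 then α (p+1)
      else if j0 ≤ p + 1 ∧ p + 1 ≤ k then max (α (p+1) - 1) (-1)
      else if p = k then -1 else 0
  else
    fun p =>
      if p = 1 then α 1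
      else if 2 ≤ p ∧ p + 1 ≤ k then α (p+1)
      else if p = k then -1 else 0

/-- `α^{O_Z(d)}`. -/
def OZdbkt (n k : ℕ) (α : ℕ → ℤ) : ℕ → ℕ → ℤ
  | 0 => α
  | d+1 => OZ1bkt n k (OZdbkt n k α d)

/-- `Comp_BKT(d)`. -/
def CompBKT (n k d : ℕ) (α : ℕ → ℤ) : Prop :=
  IsBKTodd n k α ∧ α 1 = 2*(n:ℤ)+1-k ∧
  (OZdbkt n k α (d-1)) 2 - (elld k (OZdbkt n k α (d-1)) (-1) 2 : ℤ) = 2*((n:ℤ)+1-k)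

/-- `ℓ_{-1}(α) = max {j : α_j > -1}`. -/
def ellNeg (k : ℕ) (α : ℕ → ℤ) : ℕ :=
  ((Finset.Icc 1 k).filter (fun j => (-1:ℤ) < α j)).sup id

/-- `α^{O_Y(1)} = (α_2, …, α_{ℓ_{-1}(α)}, 0, …, 0)` for `α ∈ BKT(k, 2n+1)` with
`α_1 = 2n+1-k`. -/
def OY1bkt (k : ℕ) (α : ℕ → ℤ) (j : ℕ) : ℤ :=
  if 1 ≤ j ∧ j + 1 ≤ ellNeg k α then α (j+1) else 0

/-! ### Correspondences between partitions and Weyl group elements -/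

/-- The 01-word correspondence between `μ ∈ BC(k, 2n+2)` and `w ∈ W^P`: for a 1-indexed
value `a ∈ {1, …, n+1}`, `a` occurs among the first `k` values of `w` iff `D(μ)(a) = 1`,
and `bar a` occurs iff `D(μ)(2n+3-a) = 1`. -/
def BCrel (n k : ℕ) (μ : ℕ → ℤ) (w : Equiv.Perm (Fin (2*n+2))) : Prop :=
  ∀ i, 1 ≤ i → i ≤ n+1 →
    ((fn n (i-1) ∈ valSet n k w) ↔ Dword k (2*n+2) μ i) ∧
    ((fn n (2*n+2-i) ∈ valSet n k w) ↔ Dword k (2*n+2) μ (2*n+3-i))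

/-- The BKT correspondence between `β ∈ BKT(k, 2n+2)` and `w ∈ W^P`:
`β_j = 2n+3-k-w(j) + #{i < j : w(i)+w(j) > 2n+3}` (1-indexed values). -/
def BKTrel (n k : ℕ) (β : ℕ → ℤ) (w : Equiv.Perm (Fin (2*n+2))) : Prop :=
  ∀ j, 1 ≤ j → j ≤ k →
    β j = 2*(n:ℤ)+3-k - ((w (fn n (j-1)) : ℕ) + 1) +
      (((Finset.Icc 1 (j-1)).filter
        (fun i => 2*n+1 < (w (fn n (i-1)) : ℕ) + (w (fn n (j-1)) : ℕ))).card : ℤ)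


/-! ### Signed permutations and their Coxeter length -/

lemma fn_val {m i : ℕ} (h : i < 2*m+2) : ((fn m i : Fin (2*m+2)) : ℕ) = i := Nat.mod_eq_of_lt h

lemma fn_coe {m : ℕ} (x : Fin (2*m+2)) : fn m (x : ℕ) = x := Fin.ext (fn_val x.isLt)

lemma bar_fn {m j : ℕ} (h : j < 2*m+2) : bar m (fn m j) = fn m (2*m+1-j) := by
  apply Fin.ext
  rw [fn_val (by omega)]
  simp [bar, fn_val h]

lemma perm_apply_inv {α : Type*} (u : Equiv.Perm α) (y : α) : u (u⁻¹ y) = y :=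
  u.apply_symm_apply y

lemma perm_inv_apply {α : Type*} (u : Equiv.Perm α) (y : α) : u⁻¹ (u y) = y :=
  u.symm_apply_apply y

lemma mem_Weyl_iff {m : ℕ} {v : Equiv.Perm (Fin (2*m+2))} :
    v ∈ Weyl m ↔ ∀ x, v (bar m x) = bar m (v x) := by
  simp only [Weyl, Subgroup.mem_centralizer_singleton_iff, Equiv.ext_iff, Equiv.Perm.mul_apply]
  exact Iff.rfl

lemma Weyl_apply_fn {m : ℕ} {v : Equiv.Perm (Fin (2*m+2))} (hv : v ∈ Weyl m) {j : ℕ}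
    (hj : j < 2*m+2) : ((v (fn m (2*m+1-j)) : Fin _) : ℕ) = 2*m+1 - (v (fn m j) : ℕ) := by
  rw [← bar_fn hj, mem_Weyl_iff.1 hv]
  rfl

lemma sRefl_val {m i : ℕ} (hi : 1 ≤ i) (him : i ≤ m) (x : Fin (2*m+2)) :
    ((sRefl m i x : Fin _) : ℕ) = if (x:ℕ) = i-1 then i else if (x:ℕ) = i then i-1
      else if (x:ℕ) = 2*m+2-i then 2*m+1-i else if (x:ℕ) = 2*m+1-i then 2*m+2-i else x := by
  have h1 : ((fn m (i-1) : Fin _) : ℕ) = i-1 := fn_val (by omega)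
  have h2 : ((fn m i : Fin _) : ℕ) = i := fn_val (by omega)
  have h3 : ((fn m (2*m+2-i) : Fin _) : ℕ) = 2*m+2-i := fn_val (by omega)
  have h4 : ((fn m (2*m+1-i) : Fin _) : ℕ) = 2*m+1-i := fn_val (by omega)
  simp only [sRefl, if_pos him, Equiv.Perm.mul_apply, Equiv.swap_apply_def, Fin.ext_iff,
    apply_ite Fin.val, h1, h2, h3, h4]
  split_ifs <;> omega

lemma sRefl_last_val {m : ℕ} (x : Fin (2*m+2)) :
    ((sRefl m (m+1) x : Fin _) : ℕ) = if (x:ℕ) = m then m+1 else if (x:ℕ) = m+1 then m else x := by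
  have h1 : ((fn m m : Fin _) : ℕ) = m := fn_val (by omega)
  have h2 : ((fn m (m+1) : Fin _) : ℕ) = m+1 := fn_val (by omega)
  simp only [sRefl, if_neg (show ¬ (m+1 ≤ m) by omega), Equiv.swap_apply_def, Fin.ext_iff]
  split_ifs <;> simp_all

lemma sRefl_mem_Weyl {m i : ℕ} (hi : 1 ≤ i) (him : i ≤ m+1) : sRefl m i ∈ Weyl m := by
  rw [mem_Weyl_iff]
  intro x
  apply Fin.ext
  have hx := x.isLt
  rcases Nat.lt_or_ge m i with h | h
  · obtain rfl : i = m+1 := by omega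
    simp only [sRefl_last_val, bar]
    split_ifs <;> omega
  · simp only [sRefl_val hi h, bar]
    split_ifs <;> omega

lemma sRefl_mul_self {m i : ℕ} (hi : 1 ≤ i) (him : i ≤ m+1) : sRefl m i * sRefl m i = 1 := by
  ext x
  have hx := x.isLt
  simp only [Equiv.Perm.mul_apply, Equiv.Perm.one_apply]
  rcases Nat.lt_or_ge m i with h | h
  · obtain rfl : i = m+1 := by omega
    simp only [sRefl_last_val]
    split_ifs <;> omega
  · simp only [sRefl_val hi h]
    split_ifs <;> omega

lemma mul_sRefl_mul_sRefl {m i : ℕ} (hi : 1 ≤ i) (him : i ≤ m+1)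
    (v : Equiv.Perm (Fin (2*m+2))) : v * sRefl m i * sRefl m i = v := by
  rw [mul_assoc, sRefl_mul_self hi him, mul_one]

lemma sRefl_apply_left {m i : ℕ} (hi : 1 ≤ i) (him : i ≤ m+1) :
    sRefl m i (fn m (i-1)) = fn m i := by
  apply Fin.ext
  rcases Nat.lt_or_ge m i with h | h
  · obtain rfl : i = m+1 := by omega
    rw [sRefl_last_val, fn_val (by omega), fn_val (by omega)]
    simp
  · rw [sRefl_val hi h, fn_val (by omega), fn_val (by omega)]
    simp

lemma sRefl_apply_right {m i : ℕ} (hi : 1 ≤ i) (him : i ≤ m+1) :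
    sRefl m i (fn m i) = fn m (i-1) := by
  rw [← sRefl_apply_left hi him, ← Equiv.Perm.mul_apply, sRefl_mul_self hi him]
  rfl

lemma sRefl_apply_of_ne {m i j : ℕ} (hi : 1 ≤ i) (him : i ≤ m+1) (hj : j ≤ m)
    (h1 : j ≠ i-1) (h2 : j ≠ i) : sRefl m i (fn m j) = fn m j := by
  apply Fin.ext
  rcases Nat.lt_or_ge m i with h | h
  · obtain rfl : i = m+1 := by omega
    rw [sRefl_last_val, fn_val (by omega)]
    split_ifs <;> omega
  · rw [sRefl_val hi h, fn_val (by omega)]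
    split_ifs <;> omega

/-- The number of inversions of a permutation. -/
def invCount {N : ℕ} (w : Equiv.Perm (Fin N)) : ℕ :=
  (Finset.univ.filter (fun p : Fin N × Fin N => p.1 < p.2 ∧ w p.2 < w p.1)).card

lemma invCount_mul_swap {N : ℕ} (w : Equiv.Perm (Fin N)) (a b : Fin N) (hab : (b:ℕ) = a+1)
    (h : w a < w b) : invCount (w * Equiv.swap a b) = invCount w + 1 := by
  unfold invCount
  set e : Fin N × Fin N ≃ Fin N × Fin N :=
    Equiv.prodCongr (Equiv.swap a b) (Equiv.swap a b) with he
  have hlt : a < b := by rw [Fin.lt_def]; omega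
  have key : (Finset.univ.filter (fun p : Fin N × Fin N =>
      p.1 < p.2 ∧ (w * Equiv.swap a b) p.2 < (w * Equiv.swap a b) p.1)) =
      insert (a, b) ((Finset.univ.filter
        (fun p : Fin N × Fin N => p.1 < p.2 ∧ w p.2 < w p.1)).map e.toEmbedding) := by
    ext ⟨x, y⟩
    have hs : e.symm (x, y) = (Equiv.swap a b x, Equiv.swap a b y) := by
      simp [he, Equiv.symm_swap]
    rw [Finset.mem_insert, Finset.mem_map_equiv, hs]
    simp only [Finset.mem_filter, Finset.mem_univ, true_and, Prod.mk.injEq]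
    simp only [Equiv.Perm.mul_apply]
    by_cases hxy : x = a ∧ y = b
    · obtain ⟨rfl, rfl⟩ := hxy
      simp [hlt, h]
    by_cases hyx : x = b ∧ y = a
    · obtain ⟨rfl, rfl⟩ := hyx
      have := h.le
      simp [hlt, hlt.ne', not_lt.2 this]
    have : x < y ↔ Equiv.swap a b x < Equiv.swap a b y := by
      simp only [Equiv.swap_apply_def]
      simp only [Fin.ext_iff] at hxy hyx ⊢
      split_ifs <;> simp only [Fin.lt_def] <;> omega
    rw [this]
    tauto
  rw [key, Finset.card_insert_of_notMem, Finset.card_map]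
  rw [Finset.mem_map_equiv]
  simp [he, Equiv.symm_swap, hlt.le]

/-- The number of barred values of a signed permutation. -/
def negCount (m : ℕ) (w : Equiv.Perm (Fin (2*m+2))) : ℕ :=
  (Finset.univ.filter (fun j : Fin (2*m+2) => (j:ℕ) ≤ m ∧ m < (w j : ℕ))).card

/-- Twice the Coxeter length of a signed permutation, computed from inversions. -/
def twiceLen (m : ℕ) (w : Equiv.Perm (Fin (2*m+2))) : ℕ := invCount w + negCount m w

lemma twiceLen_mul_sRefl_of_lt {m i : ℕ} (hi : 1 ≤ i) (him : i ≤ m+1)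
    {v : Equiv.Perm (Fin (2*m+2))} (hv : v ∈ Weyl m) (h : v (fn m (i-1)) < v (fn m i)) :
    twiceLen m (v * sRefl m i) = twiceLen m v + 2 := by
  unfold twiceLen
  rcases Nat.lt_or_ge m i with hm | hm
  · obtain rfl : i = m+1 := by omega
    have hinv : invCount (v * sRefl m (m+1)) = invCount v + 1 := by
      rw [sRefl, if_neg (by omega)]
      exact invCount_mul_swap _ _ _ (by rw [fn_val (by omega), fn_val (by omega)]) h
    have hb := Weyl_apply_fn hv (j := m) (by omega)
    rw [show 2*m+1-m = m+1 by omega] at hb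
    rw [Nat.add_sub_cancel, Fin.lt_def] at h
    have hneg : negCount m (v * sRefl m (m+1)) = negCount m v + 1 := by
      unfold negCount
      rw [show (Finset.univ.filter (fun j : Fin (2*m+2) =>
          (j:ℕ) ≤ m ∧ m < ((v * sRefl m (m+1)) j : ℕ))) = insert (fn m m)
          (Finset.univ.filter (fun j : Fin (2*m+2) => (j:ℕ) ≤ m ∧ m < (v j : ℕ))) from ?_,
        Finset.card_insert_of_notMem]
      · simp only [Finset.mem_filter, Finset.mem_univ, true_and]
        omega
      · ext j
        simp only [Finset.mem_insert, Finset.mem_filter, Finset.mem_univ, true_and]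
        rw [Equiv.Perm.mul_apply]
        by_cases hj : j = fn m m
        · subst hj
          have := sRefl_apply_left (m := m) (i := m+1) (by omega) le_rfl
          rw [Nat.add_sub_cancel] at this
          rw [this, fn_val (by omega)]
          simp only [le_refl, true_and, true_or, iff_true]
          omega
        · simp only [hj, false_or]
          refine and_congr_right fun hjm => ?_
          have hne : (j:ℕ) ≠ m := fun hc => hj (Fin.ext (by rw [hc, fn_val (by omega)]))
          have := sRefl_apply_of_ne (m := m) (i := m+1) (by omega) le_rfl hjm
            (by omega) (by omega)
          rw [fn_coe] at this
          rw [this]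
    omega
  · have hneg : negCount m (v * sRefl m i) = negCount m v := by
      unfold negCount
      rw [← Finset.card_map (sRefl m i).toEmbedding]
      congr 1
      ext j
      rw [Finset.mem_map_equiv]
      simp only [Finset.mem_filter, Finset.mem_univ, true_and]
      rw [Equiv.Perm.mul_apply, Equiv.apply_symm_apply]
      refine and_congr_left fun _ => ?_
      have hinv : (sRefl m i).symm = sRefl m i := by
        rw [← Equiv.Perm.inv_def, inv_eq_iff_mul_eq_one, sRefl_mul_self hi him]
      rw [hinv, sRefl_val hi hm]
      split_ifs <;> omega
    have hinv : invCount (v * sRefl m i) = invCount v + 2 := by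
      rw [sRefl, if_pos hm, ← mul_assoc, Equiv.swap_comm (fn m (2*m+2-i)), invCount_mul_swap,
        invCount_mul_swap]
      · rw [fn_val (by omega), fn_val (by omega)]; omega
      · exact h
      · rw [fn_val (by omega), fn_val (by omega)]; omega
      · have e1 := Weyl_apply_fn hv (j := i) (by omega)
        have e2 := Weyl_apply_fn hv (j := i-1) (by omega)
        rw [show 2*m+1-(i-1) = 2*m+2-i by omega] at e2
        have ne : ∀ a b, a < 2*m+2 → b < 2*m+2 → a ≠ b → fn m a ≠ fn m b := by
          intro a b ha hb hab hc
          apply hab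
          rw [← fn_val ha, hc, fn_val hb]
        simp only [Equiv.Perm.mul_apply]
        rw [Equiv.swap_apply_of_ne_of_ne (ne _ _ (by omega) (by omega) (by omega))
            (ne _ _ (by omega) (by omega) (by omega)),
          Equiv.swap_apply_of_ne_of_ne (ne _ _ (by omega) (by omega) (by omega))
            (ne _ _ (by omega) (by omega) (by omega)), Fin.lt_def, e1, e2]
        have := (v (fn m i)).isLt
        rw [Fin.lt_def] at h
        omega
    omega

lemma apply_fn_ne {m i : ℕ} (hi : 1 ≤ i) (him : i ≤ m+1) (v : Equiv.Perm (Fin (2*m+2))) :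
    v (fn m (i-1)) ≠ v (fn m i) := by
  intro h
  have h1 := fn_val (m := m) (i := i-1) (by omega)
  rw [v.injective h, fn_val (by omega)] at h1
  omega

lemma twiceLen_mul_sRefl_of_gt {m i : ℕ} (hi : 1 ≤ i) (him : i ≤ m+1)
    {v : Equiv.Perm (Fin (2*m+2))} (hv : v ∈ Weyl m) (h : v (fn m i) < v (fn m (i-1))) :
    twiceLen m (v * sRefl m i) + 2 = twiceLen m v := by
  rw [← twiceLen_mul_sRefl_of_lt hi him (mul_mem hv (sRefl_mem_Weyl hi him)),
    mul_sRefl_mul_sRefl hi him]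
  rwa [Equiv.Perm.mul_apply, Equiv.Perm.mul_apply, sRefl_apply_left hi him,
    sRefl_apply_right hi him]

lemma twiceLen_one (m : ℕ) : twiceLen m 1 = 0 := by
  simp only [twiceLen, invCount, negCount, Nat.add_eq_zero_iff, Finset.card_eq_zero,
    Finset.filter_eq_empty_iff]
  constructor
  · rintro x - ⟨h1, h2⟩
    exact h1.asymm h2
  · rintro x - ⟨h1, h2⟩
    exact h2.not_ge h1

lemma eq_one_of_forall_lt {m : ℕ} {v : Equiv.Perm (Fin (2*m+2))} (hv : v ∈ Weyl m)
    (h : ∀ i, 1 ≤ i → i ≤ m+1 → v (fn m (i-1)) < v (fn m i)) : v = 1 := by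
  have hmono : StrictMono v := by
    refine (Fin.strictMono_iff_lt_succ (n := 2*m+1) (f := v)).2 fun j => ?_
    have e1 : j.castSucc = fn m j := (fn_coe (m := m) j.castSucc).symm
    have e2 : j.succ = fn m (j+1) := (fn_coe (m := m) j.succ).symm
    have hj := j.isLt
    rw [e1, e2]
    rcases Nat.lt_or_ge m j with hm | hm
    · have := h (2*m+1-j) (by omega) (by omega)
      have a1 := Weyl_apply_fn hv (j := 2*m+1-j) (by omega)
      have a2 := Weyl_apply_fn hv (j := 2*m+1-j-1) (by omega)
      rw [show 2*m+1-(2*m+1-(j:ℕ)) = j by omega] at a1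
      rw [show 2*m+1-(2*m+1-(j:ℕ)-1) = j+1 by omega] at a2
      rw [Fin.lt_def] at this ⊢
      have := (v (fn m (2*m+1-j))).isLt
      omega
    · exact h (j+1) (by omega) (by omega)
  ext x
  exact congrArg Fin.val (congrFun (StrictMono.eq_id hmono) x)

lemma exists_descent {m : ℕ} {v : Equiv.Perm (Fin (2*m+2))} (hv : v ∈ Weyl m) (h1 : v ≠ 1) :
    ∃ i, 1 ≤ i ∧ i ≤ m+1 ∧ v (fn m i) < v (fn m (i-1)) := by
  by_contra! hc
  exact h1 (eq_one_of_forall_lt hv fun i hi him =>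
    lt_of_le_of_ne (hc i hi him) (apply_fn_ne hi him v))

lemma exists_word {m : ℕ} {v : Equiv.Perm (Fin (2*m+2))} (hv : v ∈ Weyl m) :
    ∃ l : List ℕ, 2 * l.length = twiceLen m v ∧ (∀ i ∈ l, 1 ≤ i ∧ i ≤ m+1) ∧
      (l.map (sRefl m)).prod = v := by
  induction hr : twiceLen m v using Nat.strong_induction_on generalizing v with
  | _ r ih =>
    by_cases h1 : v = 1
    · refine ⟨[], ?_, by simp, by simp [h1]⟩
      rw [← hr, h1, twiceLen_one]
      rfl
    · obtain ⟨i, hi, him, hd⟩ := exists_descent hv h1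
      have hl := twiceLen_mul_sRefl_of_gt hi him hv hd
      obtain ⟨l, hl1, hl2, hl3⟩ := ih _ (by omega) (mul_mem hv (sRefl_mem_Weyl hi him)) rfl
      refine ⟨l ++ [i], ?_, ?_, ?_⟩
      · simp only [List.length_append, List.length_singleton]
        omega
      · intro j hj
        rcases List.mem_append.1 hj with hj | hj
        · exact hl2 j hj
        · rw [List.mem_singleton.1 hj]
          exact ⟨hi, him⟩
      · rw [List.map_append, List.prod_append, hl3, List.map_singleton, List.prod_singleton,
          mul_sRefl_mul_sRefl hi him]

lemma prod_mem_Weyl_and_twiceLen_le {m : ℕ} (l : List ℕ) (hl : ∀ i ∈ l, 1 ≤ i ∧ i ≤ m+1) :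
    (l.map (sRefl m)).prod ∈ Weyl m ∧ twiceLen m (l.map (sRefl m)).prod ≤ 2 * l.length := by
  induction l using List.reverseRecOn with
  | nil => simp [twiceLen_one]
  | append_singleton l i ih =>
    obtain ⟨ih1, ih2⟩ := ih fun j hj => hl j (by simp [hj])
    obtain ⟨hi, him⟩ := hl i (by simp)
    rw [List.map_append, List.prod_append, List.map_singleton, List.prod_singleton,
      List.length_append, List.length_singleton]
    refine ⟨mul_mem ih1 (sRefl_mem_Weyl hi him), ?_⟩
    rcases lt_or_gt_of_ne (apply_fn_ne hi him (l.map (sRefl m)).prod) with h | h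
    · rw [twiceLen_mul_sRefl_of_lt hi him ih1 h]
      omega
    · have := twiceLen_mul_sRefl_of_gt hi him ih1 h
      omega

lemma two_mul_len {m : ℕ} {v : Equiv.Perm (Fin (2*m+2))} (hv : v ∈ Weyl m) :
    2 * len m v = twiceLen m v := by
  obtain ⟨l, hl1, hl2, hl3⟩ := exists_word hv
  apply le_antisymm
  · rw [← hl1]
    exact Nat.mul_le_mul_left 2 (Nat.sInf_le ⟨l, rfl, hl2, hl3⟩)
  · obtain ⟨l', h1, h2, h3⟩ := Nat.sInf_mem (s := {r | ∃ l : List ℕ, l.length = r ∧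
      (∀ i ∈ l, 1 ≤ i ∧ i ≤ m+1) ∧ (l.map (sRefl m)).prod = v}) ⟨_, l, rfl, hl2, hl3⟩
    have := (prod_mem_Weyl_and_twiceLen_le l' h2).2
    rwa [h3, h1] at this

lemma len_lt_mul_sRefl_iff {m i : ℕ} (hi : 1 ≤ i) (him : i ≤ m+1)
    {v : Equiv.Perm (Fin (2*m+2))} (hv : v ∈ Weyl m) :
    len m v < len m (v * sRefl m i) ↔ v (fn m (i-1)) < v (fn m i) := by
  have h1 := two_mul_len hv
  have h2 := two_mul_len (mul_mem hv (sRefl_mem_Weyl hi him))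
  rcases lt_or_gt_of_ne (apply_fn_ne hi him v) with h | h
  · have := twiceLen_mul_sRefl_of_lt hi him hv h
    simp only [h, iff_true]
    omega
  · have := twiceLen_mul_sRefl_of_gt hi him hv h
    simp only [h.asymm, iff_false]
    omega

/-! ### Cosets of the maximal parabolic subgroup -/

lemma sRefl_mem_WP {m k i : ℕ} (hi : 1 ≤ i) (him : i ≤ m+1) (hik : i ≠ k) :
    sRefl m i ∈ WP m k :=
  Subgroup.subset_closure ⟨i, hi, him, hik, rfl⟩

lemma isMinRep.lt {m k i : ℕ} {w : Equiv.Perm (Fin (2*m+2))} (hw : isMinRep m k w)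
    (hi : 1 ≤ i) (him : i ≤ m+1) (hik : i ≠ k) : w (fn m (i-1)) < w (fn m i) := by
  refine (lt_or_gt_of_ne (apply_fn_ne hi him w)).resolve_right fun h => ?_
  have h1 := two_mul_len hw.1
  have h2 := two_mul_len (mul_mem hw.1 (sRefl_mem_Weyl hi him))
  have h3 := twiceLen_mul_sRefl_of_gt hi him hw.1 h
  have h4 := hw.2 _ (sRefl_mem_WP hi him hik)
  omega

lemma sRefl_lt_iff {m k i : ℕ} (hi : 1 ≤ i) (him : i ≤ m+1) (hik : i ≠ k)
    (hkm : k ≤ m) (x : Fin (2*m+2)) : ((sRefl m i x : Fin _) : ℕ) < k ↔ (x : ℕ) < k := by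
  rcases Nat.lt_or_ge m i with h | h
  · obtain rfl : i = m+1 := by omega
    rw [sRefl_last_val]
    split_ifs <;> omega
  · rw [sRefl_val hi h]
    split_ifs <;> omega

lemma WP_lt_iff {m k : ℕ} (hkm : k ≤ m) {v : Equiv.Perm (Fin (2*m+2))} (hv : v ∈ WP m k)
    (x : Fin (2*m+2)) : ((v x : Fin _) : ℕ) < k ↔ (x : ℕ) < k := by
  induction hv using Subgroup.closure_induction generalizing x with
  | mem v hv =>
    obtain ⟨i, hi, him, hik, rfl⟩ := hv
    exact sRefl_lt_iff hi him hik hkm x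
  | one => rfl
  | mul a b _ _ iha ihb => rw [Equiv.Perm.mul_apply, iha, ihb]
  | inv a _ iha => rw [← iha, perm_apply_inv]

lemma mem_WP_of_lt_iff {m k : ℕ} (hkm : k ≤ m) {v : Equiv.Perm (Fin (2*m+2))} (hv : v ∈ Weyl m)
    (h : ∀ x : Fin (2*m+2), ((v x : Fin _) : ℕ) < k ↔ (x : ℕ) < k) : v ∈ WP m k := by
  induction hr : twiceLen m v using Nat.strong_induction_on generalizing v with
  | _ r ih =>
    by_cases h1 : v = 1
    · rw [h1]
      exact one_mem _
    · obtain ⟨i, hi, him, hd⟩ := exists_descent hv h1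
      have hl := twiceLen_mul_sRefl_of_gt hi him hv hd
      have hik : i ≠ k := by
        rintro rfl
        have a1 := (h (fn m i)).not
        have a2 := h (fn m (i-1))
        rw [fn_val (by omega)] at a1 a2
        rw [Fin.lt_def] at hd
        omega
      have := ih _ (by omega) (mul_mem hv (sRefl_mem_Weyl hi him))
        (fun x => by rw [Equiv.Perm.mul_apply, h, sRefl_lt_iff hi him hik hkm]) rfl
      rw [← mul_sRefl_mul_sRefl hi him v]
      exact mul_mem this (sRefl_mem_WP hi him hik)

/-- The values of `v` in (0-indexed) positions at most `m`, extended by zero. -/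
def window (m : ℕ) (v : Equiv.Perm (Fin (2*m+2))) (j : ℕ) : ℕ :=
  if j ≤ m then (v (fn m j) : ℕ) else 0

lemma window_of_le {m j : ℕ} (hj : j ≤ m) (v : Equiv.Perm (Fin (2*m+2))) :
    window m v j = (v (fn m j) : ℕ) := if_pos hj

lemma window_image_eq_iff {m k : ℕ} (hkm : k ≤ m) {u v : Equiv.Perm (Fin (2*m+2))} :
    (window m u '' Set.Iio k = window m v '' Set.Iio k) ↔
      ∀ x : Fin (2*m+2), ((u⁻¹ (v x) : Fin _) : ℕ) < k ↔ (x : ℕ) < k := by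
  have key : ∀ (u : Equiv.Perm (Fin (2*m+2))) (y : Fin (2*m+2)),
      (y:ℕ) ∈ window m u '' Set.Iio k ↔ ((u⁻¹ y : Fin _) : ℕ) < k := by
    intro u y
    constructor
    · rintro ⟨j, hj, he⟩
      simp only [Set.mem_Iio] at hj
      rw [window_of_le (by omega)] at he
      have := Fin.ext he
      rw [← this, perm_inv_apply, fn_val (by omega)]
      exact hj
    · intro h
      refine ⟨_, h, ?_⟩
      rw [window_of_le (by omega), fn_coe, perm_apply_inv]
  constructor
  · intro h x
    rw [← key, h, key, perm_inv_apply]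
  · intro h
    have hlt : ∀ (u : Equiv.Perm (Fin (2*m+2))), ∀ y ∈ window m u '' Set.Iio k, y < 2*m+2 := by
      rintro u _ ⟨j, hj, rfl⟩
      simp only [Set.mem_Iio] at hj
      rw [window_of_le (by omega)]
      exact Fin.isLt _
    ext y
    constructor
    · intro hy
      have := (key u ⟨y, hlt u y hy⟩).1 hy
      refine (key v ⟨y, hlt u y hy⟩).2 ?_
      rw [← h, perm_apply_inv]
      exact this
    · intro hy
      have := (key v ⟨y, hlt v y hy⟩).1 hy
      refine (key u ⟨y, hlt v y hy⟩).2 ?_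
      rw [← h, perm_apply_inv] at this
      exact this

lemma cosetEq_iff_window {m k : ℕ} (hkm : k ≤ m) {u v : Equiv.Perm (Fin (2*m+2))}
    (hu : u ∈ Weyl m) (hv : v ∈ Weyl m) :
    cosetEq m k u v ↔ window m u '' Set.Iio k = window m v '' Set.Iio k := by
  rw [window_image_eq_iff hkm]
  exact ⟨fun h => WP_lt_iff hkm h, mem_WP_of_lt_iff hkm (mul_mem (inv_mem hu) hv)⟩

/-! ### Hecke products in window notation -/

/-- The effect of a Hecke step on windows. -/
def windowStep (m : ℕ) (f : ℕ → ℕ) (i j : ℕ) : ℕ :=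
  if i ≤ m then
    if j = i-1 then max (f (i-1)) (f i) else if j = i then min (f (i-1)) (f i) else f j
  else if j = m then max (f m) (2*m+1 - f m) else f j

/-- The effect of a modified Hecke step on windows. -/
def windowStepK (m k : ℕ) (f : ℕ → ℕ) (i j : ℕ) : ℕ :=
  if i = k then if j = k-1 then f k else if j = k then f (k-1) else f j
  else windowStep m f i j

/-- The effect of a Hecke word on windows. -/
def sweep (m : ℕ) (f : ℕ → ℕ) (l : List ℕ) : ℕ → ℕ := l.foldl (windowStep m) f

/-- The effect of a modified Hecke word on windows. -/
def sweepK (m k : ℕ) (f : ℕ → ℕ) (l : List ℕ) : ℕ → ℕ := l.foldl (windowStepK m k) f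

lemma sweep_append (m : ℕ) (f : ℕ → ℕ) (l l' : List ℕ) :
    sweep m f (l ++ l') = sweep m (sweep m f l) l' := List.foldl_append

lemma sweepK_append (m k : ℕ) (f : ℕ → ℕ) (l l' : List ℕ) :
    sweepK m k f (l ++ l') = sweepK m k (sweepK m k f l) l' := List.foldl_append

lemma sweep_singleton (m i : ℕ) (f : ℕ → ℕ) : sweep m f [i] = windowStep m f i := rfl

lemma sweepK_singleton (m k i : ℕ) (f : ℕ → ℕ) : sweepK m k f [i] = windowStepK m k f i := rfl

lemma sweepK_eq_sweep {m k : ℕ} (l : List ℕ) (hl : k ∉ l) (f : ℕ → ℕ) :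
    sweepK m k f l = sweep m f l := by
  induction l generalizing f with
  | nil => rfl
  | cons i l ih =>
    have hik : i ≠ k := fun h => hl (by simp [h])
    have : windowStepK m k f i = windowStep m f i := by
      funext j
      simp [windowStepK, hik]
    simp only [sweepK, sweep, List.foldl_cons] at ih ⊢
    rw [ih (fun h => hl (List.mem_cons_of_mem _ h)), this]

lemma window_mul_sRefl {m i : ℕ} (hi : 1 ≤ i) (him : i ≤ m) (v : Equiv.Perm (Fin (2*m+2)))
    (j : ℕ) : window m (v * sRefl m i) j =
      if j = i-1 then window m v i else if j = i then window m v (i-1) else window m v j := by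
  simp only [window, Equiv.Perm.mul_apply]
  split_ifs <;> first
    | omega
    | (subst_vars; rw [sRefl_apply_left hi (by omega)])
    | (subst_vars; rw [sRefl_apply_right hi (by omega)])
    | rw [sRefl_apply_of_ne hi (by omega) (by omega) (by omega) (by omega)]

lemma hStep_mem_Weyl {m i : ℕ} (hi : 1 ≤ i) (him : i ≤ m+1) {v : Equiv.Perm (Fin (2*m+2))}
    (hv : v ∈ Weyl m) : hStep m v i ∈ Weyl m := by
  unfold hStep
  split_ifs
  · exact mul_mem hv (sRefl_mem_Weyl hi him)
  · exact hv

lemma window_hStep {m i : ℕ} (hi : 1 ≤ i) (him : i ≤ m+1) {v : Equiv.Perm (Fin (2*m+2))}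
    (hv : v ∈ Weyl m) : window m (hStep m v i) = windowStep m (window m v) i := by
  have hiff := len_lt_mul_sRefl_iff hi him hv
  rw [Fin.lt_def] at hiff
  funext j
  unfold hStep
  simp only [hiff]
  rcases Nat.lt_or_ge m i with hm | hm
  · obtain rfl : i = m+1 := by omega
    have hb := Weyl_apply_fn hv (j := m) (by omega)
    rw [show 2*m+1-m = m+1 by omega] at hb
    have hl := sRefl_apply_left (m := m) hi him
    simp only [Nat.add_sub_cancel] at hl ⊢
    simp only [windowStep, if_neg (show ¬ (m+1 ≤ m) by omega)]
    by_cases hj : j = m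
    · subst hj
      simp only [if_true, window_of_le le_rfl]
      split_ifs
      · rw [Equiv.Perm.mul_apply, hl]
        omega
      · omega
    · rw [if_neg hj]
      split_ifs
      · unfold window
        split_ifs
        · rw [Equiv.Perm.mul_apply, sRefl_apply_of_ne hi him (by omega) (by omega) (by omega)]
        · rfl
      · rfl
  · rw [← window_of_le (by omega), ← window_of_le hm, windowStep, if_pos hm]
    by_cases h : window m v (i-1) < window m v i
    · rw [if_pos h, window_mul_sRefl hi hm]
      split_ifs <;> omega
    · rw [if_neg h]
      split_ifs with h1 h2
      · rw [h1]; omega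
      · rw [h2]; omega
      · rfl

lemma hStepK_of_ne {m k i : ℕ} (hik : i ≠ k) (v : Equiv.Perm (Fin (2*m+2))) :
    hStepK m k v i = hStep m v i := by
  simp [hStepK, hStep, hik]

lemma hStepK_self {m k : ℕ} (v : Equiv.Perm (Fin (2*m+2))) :
    hStepK m k v k = v * sRefl m k := by
  simp [hStepK]

lemma window_hWord {m : ℕ} (l : List ℕ) (hl : ∀ i ∈ l, 1 ≤ i ∧ i ≤ m+1)
    {v : Equiv.Perm (Fin (2*m+2))} (hv : v ∈ Weyl m) :
    hWord m v l ∈ Weyl m ∧ window m (hWord m v l) = sweep m (window m v) l := by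
  induction l generalizing v with
  | nil => exact ⟨hv, rfl⟩
  | cons i l ih =>
    obtain ⟨hi, him⟩ := hl i (by simp)
    have := ih (fun j hj => hl j (by simp [hj])) (hStep_mem_Weyl hi him hv)
    rwa [window_hStep hi him hv] at this

lemma window_hWordK {m k : ℕ} (hkm : k ≤ m) (l : List ℕ) (hl : ∀ i ∈ l, 1 ≤ i ∧ i ≤ m+1)
    {v : Equiv.Perm (Fin (2*m+2))} (hv : v ∈ Weyl m) :
    hWordK m k v l ∈ Weyl m ∧ window m (hWordK m k v l) = sweepK m k (window m v) l := by
  induction l generalizing v with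
  | nil => exact ⟨hv, rfl⟩
  | cons i l ih =>
    obtain ⟨hi, him⟩ := hl i (by simp)
    have hstep : hStepK m k v i ∈ Weyl m ∧
        window m (hStepK m k v i) = windowStepK m k (window m v) i := by
      by_cases hik : i = k
      · subst hik
        rw [hStepK_self]
        refine ⟨mul_mem hv (sRefl_mem_Weyl hi him), ?_⟩
        funext j
        rw [window_mul_sRefl hi hkm, windowStepK, if_pos rfl]
      · rw [hStepK_of_ne hik]
        refine ⟨hStep_mem_Weyl hi him hv, ?_⟩
        rw [window_hStep hi him hv]
        funext j
        rw [windowStepK, if_neg hik]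
    have := ih (fun j hj => hl j (by simp [hj])) hstep.1
    rwa [hstep.2] at this

/-! ### Sweeps -/

lemma windowStep_image {m i : ℕ} (hi : 1 ≤ i) (him : i ≤ m) (f : ℕ → ℕ) {S : Set ℕ}
    (hS : i-1 ∈ S ↔ i ∈ S) : windowStep m f i '' S = f '' S := by
  have h : windowStep m f i = f ∨ windowStep m f i = f ∘ Equiv.swap (i-1) i := by
    rcases le_total (f i) (f (i-1)) with hf | hf
    · left
      funext j
      simp only [windowStep, if_pos him]
      split_ifs <;> subst_vars <;> simp [hf]
    · right
      funext j
      simp only [windowStep, if_pos him, Function.comp_apply, Equiv.swap_apply_def]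
      split_ifs <;> subst_vars <;> simp [hf]
  rcases h with h | h
  · rw [h]
  · rw [h, Set.image_comp]
    congr 1
    rw [Equiv.image_eq_preimage_symm, Equiv.symm_swap]
    ext j
    simp only [Set.mem_preimage, Equiv.swap_apply_def]
    split_ifs <;> subst_vars <;> simp [hS]

lemma sweep_image {m : ℕ} {S : Set ℕ} (l : List ℕ)
    (hl : ∀ i ∈ l, 1 ≤ i ∧ i ≤ m ∧ (i-1 ∈ S ↔ i ∈ S)) (f : ℕ → ℕ) :
    sweep m f l '' S = f '' S := by
  induction l generalizing f with
  | nil => rfl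
  | cons i l ih =>
    obtain ⟨hi, him, hS⟩ := hl i (by simp)
    rw [← windowStep_image hi him f hS]
    exact ih (fun j hj => hl j (by simp [hj])) _

lemma sweep_apply_of_ne {m j : ℕ} (l : List ℕ)
    (hl : ∀ i ∈ l, i ≤ m+1 ∧ j ≠ i-1 ∧ j ≠ i) (f : ℕ → ℕ) : sweep m f l j = f j := by
  induction l generalizing f with
  | nil => rfl
  | cons i l ih =>
    obtain ⟨him, h1, h2⟩ := hl i (by simp)
    refine (ih (fun a ha => hl a (by simp [ha])) _).trans ?_
    unfold windowStep
    split_ifs <;> omega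

lemma sweep_range'_of_le {m p c : ℕ} (hm : p + c ≤ m) (f : ℕ → ℕ)
    (hf : ∀ j, p ≤ j → j ≤ p + c → f p ≤ f j) (j : ℕ) :
    sweep m f (List.range' (p+1) c) j =
      if p ≤ j ∧ j < p + c then f (j+1) else if j = p + c then f p else f j := by
  induction c generalizing j with
  | zero =>
    have : sweep m f (List.range' (p+1) 0) j = f j := rfl
    rw [this]
    split_ifs <;> first | omega | (subst_vars; rfl)
  | succ c ih =>
    have ih := ih (by omega) (fun j h1 h2 => hf j h1 (by omega))
    rw [List.range'_1_concat, sweep_append, sweep_singleton]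
    have hle := hf (p+c+1) (by omega) (by omega)
    simp only [windowStep, ih, if_pos (show p+c+1 ≤ m by omega), Nat.add_sub_cancel,
      show p + 1 + c = p + c + 1 by omega, show p + (c + 1) = p + c + 1 by omega, and_false,
      if_false, show ¬ (p + c + 1 < p + c) by omega, show p + c + 1 ≠ p + c by omega]
    split_ifs <;> first | omega | (subst_vars; simp [hle])

lemma sweep_range'_le {m p c : ℕ} (hm : p + c ≤ m) (f : ℕ → ℕ) {j : ℕ} (h1 : p ≤ j)
    (h2 : j ≤ p + c) :
    sweep m f (List.range' (p+1) c) (p+c) ≤ sweep m f (List.range' (p+1) c) j := by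
  induction c generalizing j with
  | zero =>
    obtain rfl : j = p := by omega
    exact le_rfl
  | succ c ih =>
    rw [List.range'_1_concat, sweep_append, sweep_singleton]
    have ih := fun j => @ih (by omega) j
    generalize sweep m f (List.range' (p+1) c) = g at *
    simp only [windowStep, if_pos (show p+c+1 ≤ m by omega), Nat.add_sub_cancel,
      show p + 1 + c = p + c + 1 by omega, show p + (c + 1) = p + c + 1 by omega]
    have := ih j h1
    split_ifs <;> omega

lemma sweep_range'_reverse_ge {m p c : ℕ} (hm : p + c ≤ m) (f : ℕ → ℕ) {j : ℕ} (h1 : p ≤ j)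
    (h2 : j ≤ p + c) :
    sweep m f (List.range' (p+1) c).reverse j ≤ sweep m f (List.range' (p+1) c).reverse p := by
  induction c generalizing p j with
  | zero =>
    obtain rfl : j = p := by omega
    exact le_rfl
  | succ c ih =>
    rw [List.range'_succ, List.reverse_cons, sweep_append, sweep_singleton]
    have ih := fun j => @ih (p+1) (by omega) j
    generalize sweep m f (List.range' (p+1+1) c).reverse = g at *
    simp only [windowStep, if_pos (show p+1 ≤ m by omega), Nat.add_sub_cancel]
    have := ih j
    split_ifs <;> omega

/-- The values of `f` in positions `k, …, m` together with their bars. -/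
def symRange (m : ℕ) (f : ℕ → ℕ) (k : ℕ) : Set ℕ :=
  {x | ∃ j, k ≤ j ∧ j ≤ m ∧ (x = f j ∨ x = 2*m+1 - f j)}

/-- The word of the reflection in the long root at (0-indexed) position `k`. -/
def reflWord (m k : ℕ) : List ℕ := ascList (k+1) (m+1) ++ (ascList (k+1) m).reverse

lemma mem_ascList {a b i : ℕ} : i ∈ ascList a b ↔ a ≤ i ∧ i ≤ b := by
  rw [ascList, List.mem_range'_1]
  omega

lemma mem_reflWord {m k i : ℕ} (hi : i ∈ reflWord m k) : k + 1 ≤ i ∧ i ≤ m+1 := by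
  simp only [reflWord, List.mem_append, List.mem_reverse, mem_ascList] at hi
  omega

lemma sweep_reflWord_of_lt {m k j : ℕ} (hj : j < k) (f : ℕ → ℕ) :
    sweep m f (reflWord m k) j = f j :=
  sweep_apply_of_ne _ (fun i hi => by have := mem_reflWord hi; omega) f

lemma isGreatest_sweep_reflWord {m k : ℕ} (hkm : k ≤ m) (f : ℕ → ℕ) :
    IsGreatest (symRange m f k) (sweep m f (reflWord m k) k) := by
  have hS : ∀ i ∈ ascList (k+1) m, 1 ≤ i ∧ i ≤ m ∧ (i-1 ∈ Set.Icc k m ↔ i ∈ Set.Icc k m) := by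
    intro i hi
    rw [mem_ascList] at hi
    simp only [Set.mem_Icc]
    omega
  have hword : reflWord m k = ascList (k+1) m ++ [m+1] ++ (ascList (k+1) m).reverse := by
    unfold reflWord ascList
    rw [show m+1+1-(k+1) = (m+1-(k+1)) + 1 by omega, List.range'_1_concat,
      show k+1+(m+1-(k+1)) = m+1 by omega]
  rw [hword, sweep_append, sweep_append, sweep_singleton]
  have himg := sweep_image _ hS f
  have hle := fun j (h1 : k ≤ j) (h2 : j ≤ m) => sweep_range'_le (m := m) (p := k) (c := m+1-(k+1))
    (by omega) f h1 (by omega)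
  rw [show k + (m+1-(k+1)) = m by omega] at hle
  change ∀ j, k ≤ j → j ≤ m → sweep m f (ascList (k+1) m) m ≤ sweep m f (ascList (k+1) m) j at hle
  generalize sweep m f (ascList (k+1) m) = f₁ at *
  have himg' := sweep_image (ascList (k+1) m).reverse
    (fun i hi => hS i (List.mem_reverse.1 hi)) (windowStep m f₁ (m+1))
  have hge := fun j (h1 : k ≤ j) (h2 : j ≤ m) => sweep_range'_reverse_ge (m := m) (p := k)
    (c := m+1-(k+1)) (by omega) (windowStep m f₁ (m+1)) h1 (by omega)
  change ∀ j, k ≤ j → j ≤ m → sweep m (windowStep m f₁ (m+1)) (ascList (k+1) m).reverse j ≤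
    sweep m (windowStep m f₁ (m+1)) (ascList (k+1) m).reverse k at hge
  generalize sweep m (windowStep m f₁ (m+1)) (ascList (k+1) m).reverse = g at *
  have hlast : ∀ j, windowStep m f₁ (m+1) j =
      if j = m then max (f₁ m) (2*m+1 - f₁ m) else f₁ j := by
    intro j
    rw [windowStep, if_neg (by omega)]
  generalize windowStep m f₁ (m+1) = f₂ at *
  have hup : ∀ j, k ≤ j → j ≤ m → f₂ j ≤ g k := by
    intro j h1 h2
    obtain ⟨a, ha, hag⟩ : f₂ j ∈ g '' Set.Icc k m := himg' ▸ ⟨j, ⟨h1, h2⟩, rfl⟩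
    rw [← hag]
    exact hge a ha.1 ha.2
  constructor
  · obtain ⟨j, hj, hjg⟩ : g k ∈ f₂ '' Set.Icc k m := himg' ▸ ⟨k, ⟨le_rfl, hkm⟩, rfl⟩
    obtain ⟨a, ha, haf⟩ : f₁ j ∈ f '' Set.Icc k m := himg ▸ ⟨j, hj, rfl⟩
    refine ⟨a, ha.1, ha.2, ?_⟩
    rw [haf, ← hjg, hlast]
    split_ifs with h
    · subst h
      omega
    · exact Or.inl rfl
  · rintro x ⟨j, h1, h2, hx⟩
    obtain ⟨a, ha, haf⟩ : f j ∈ f₁ '' Set.Icc k m := himg.symm ▸ ⟨j, ⟨h1, h2⟩, rfl⟩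
    have b1 := hup a ha.1 ha.2
    have b2 := hup m hkm le_rfl
    have b3 := hle a ha.1 ha.2
    rw [hlast] at b1 b2
    rw [if_pos rfl] at b2
    split_ifs at b1 with h
    · subst h
      omega
    · omega

lemma ascList_append {a b c : ℕ} (hab : a ≤ b + 1) (hbc : b ≤ c) :
    ascList a c = ascList a b ++ ascList (b+1) c := by
  unfold ascList
  have := List.range'_append_1 (s := a) (m := b+1-a) (n := c+1-(b+1))
  rw [show a + (b+1-a) = b+1 by omega, show b+1-a + (c+1-(b+1)) = c+1-a by omega] at this
  exact this.symm

lemma ascList_self (a : ℕ) : ascList a a = [a] := by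
  simp [ascList]

lemma ascList_split {a k c : ℕ} (hk : 1 ≤ k) (hak : a ≤ k) (hkc : k ≤ c) :
    ascList a c = ascList a (k-1) ++ [k] ++ ascList (k+1) c := by
  rw [ascList_append (b := k) (by omega) hkc, ascList_append (b := k-1) (by omega) (by omega),
    show k - 1 + 1 = k by omega, ascList_self]

lemma wordOY1_eq {m k : ℕ} (hk : 1 ≤ k) (hkm : k ≤ m) :
    wordOY1 m k = ascList 1 (k-1) ++ reflWord m k ++ [k] ++ (ascList 1 (k-1)).reverse := by
  rw [wordOY1, ascList_split hk hk hkm, reflWord]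
  simp

lemma wordOcirc_one_eq {m k : ℕ} (hk : 1 ≤ k) (hkm : k ≤ m) :
    wordOcirc m 1 =
      ascList 1 (k-1) ++ [k] ++ reflWord m k ++ [k] ++ (ascList 1 (k-1)).reverse := by
  have : wordOcirc m 1 = wordOcirc1 m := by simp [wordOcirc]
  rw [this, wordOcirc1, ascList_split hk hk hkm, ascList_split hk hk (c := m+1) (by omega),
    reflWord]
  simp

lemma wordOZ_one_eq_reflWord (m : ℕ) : wordOZ m 1 = reflWord m 1 := by
  simp [wordOZ, wordOZ1, reflWord]

lemma wordOZ_one_eq {m k : ℕ} (hk : 2 ≤ k) (hkm : k ≤ m) :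
    wordOZ m 1 =
      ascList 2 (k-1) ++ [k] ++ reflWord m k ++ [k] ++ (ascList 2 (k-1)).reverse := by
  have : wordOZ m 1 = wordOZ1 m := by simp [wordOZ]
  rw [this, wordOZ1, ascList_split (by omega) hk hkm,
    ascList_split (by omega) hk (c := m+1) (by omega), reflWord]
  simp

lemma mem_wordOY1 {m k i : ℕ} (hk : 1 ≤ k) (hkm : k ≤ m) (hi : i ∈ wordOY1 m k) :
    1 ≤ i ∧ i ≤ m+1 := by
  simp only [wordOY1, List.mem_append, List.mem_reverse, mem_ascList] at hi
  omega

lemma mem_wordOcirc_one {m i : ℕ} (hi : i ∈ wordOcirc m 1) : 1 ≤ i ∧ i ≤ m+1 := by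
  simp only [wordOcirc, wordOcirc1, List.replicate_one, List.flatten_singleton, List.mem_append,
    List.mem_reverse, mem_ascList] at hi
  omega

lemma mem_wordOZ_one {m i : ℕ} (hi : i ∈ wordOZ m 1) : 1 ≤ i ∧ i ≤ m+1 := by
  have := mem_reflWord (wordOZ_one_eq_reflWord m ▸ hi)
  omega

lemma symRange_congr {m k : ℕ} {f g : ℕ → ℕ} (h : ∀ j, k ≤ j → f j = g j) :
    symRange m f k = symRange m g k := by
  ext x
  simp only [symRange, Set.mem_ofPred_eq]
  refine exists_congr fun j => and_congr_right fun hj => ?_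
  rw [h j hj]

lemma image_Iio_eq {f g : ℕ → ℕ} {k P : ℕ} (hk : 1 ≤ k) (h : ∀ j, j < k-1 → g j = f (j+1))
    (hP : g (k-1) = P) : g '' Set.Iio k = f '' Set.Ico 1 k ∪ {P} := by
  ext x
  simp only [Set.mem_image, Set.mem_Iio, Set.mem_union, Set.mem_Ico, Set.mem_singleton_iff]
  constructor
  · rintro ⟨j, hj, rfl⟩
    rcases Nat.lt_or_ge j (k-1) with hj' | hj'
    · exact Or.inl ⟨j+1, by omega, (h j hj').symm⟩
    · obtain rfl : j = k-1 := by omega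
      exact Or.inr hP
  · rintro (⟨j, hj, rfl⟩ | rfl)
    · exact ⟨j-1, by omega, by rw [h _ (by omega), show j - 1 + 1 = j by omega]⟩
    · exact ⟨k-1, by omega, hP⟩

lemma sweep_wordOY1 {m k : ℕ} (hk : 1 ≤ k) (hkm : k ≤ m) (f : ℕ → ℕ) (h0 : f 0 = 0) :
    ∃ P, IsGreatest (symRange m f k) P ∧
      sweep m f (wordOY1 m k) '' Set.Iio k = f '' Set.Ico 1 k ∪ {P} := by
  rw [wordOY1_eq hk hkm, sweep_append, sweep_append, sweep_append, sweep_singleton,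
    sweep_image (S := Set.Iio k) (ascList 1 (k-1)).reverse
      (fun i hi => by
        rw [List.mem_reverse, mem_ascList] at hi
        simp only [Set.mem_Iio]
        omega)]
  have h1 := sweep_range'_of_le (m := m) (p := 0) (c := k-1+1-1) (by omega) f
    (fun j _ _ => by omega)
  change ∀ j, sweep m f (ascList 1 (k-1)) j = _ at h1
  generalize sweep m f (ascList 1 (k-1)) = f₁ at *
  have h2 := isGreatest_sweep_reflWord hkm f₁
  rw [symRange_congr (g := f) (fun j hj => by
    rw [h1, if_neg (by omega), if_neg (by omega)])] at h2
  have h3 := fun j hj => sweep_reflWord_of_lt (m := m) (k := k) (j := j) hj f₁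
  generalize sweep m f₁ (reflWord m k) = g at *
  refine ⟨_, h2, image_Iio_eq hk (fun j hj => ?_) ?_⟩
  · rw [windowStep, if_pos hkm, if_neg (by omega), if_neg (by omega), h3 j (by omega), h1,
      if_pos (by omega)]
  · rw [windowStep, if_pos hkm, if_pos rfl, h3 (k-1) (by omega), h1, if_neg (by omega),
      if_pos (by omega), h0]
    simp

lemma sweepK_wordOcirc_one {m k : ℕ} (hk : 1 ≤ k) (hkm : k ≤ m) (f : ℕ → ℕ)
    (hf : ∀ j, j < k → f 0 ≤ f j) :
    ∃ Y, IsGreatest (symRange m f (k+1) ∪ {f 0, 2*m+1 - f 0}) Y ∧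
      sweepK m k f (wordOcirc m 1) '' Set.Iio k = f '' Set.Ico 1 k ∪ {Y} := by
  have hnot : k ∉ ascList 1 (k-1) := by
    rw [mem_ascList]
    omega
  rw [wordOcirc_one_eq hk hkm, sweepK_append, sweepK_append, sweepK_append, sweepK_append,
    sweepK_singleton, sweepK_singleton, sweepK_eq_sweep _ hnot,
    sweepK_eq_sweep (ascList 1 (k-1)).reverse (by simpa using hnot),
    sweepK_eq_sweep (reflWord m k) (fun h => by have := mem_reflWord h; omega),
    sweep_image (S := Set.Iio k) (ascList 1 (k-1)).reverse
      (fun i hi => by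
        rw [List.mem_reverse, mem_ascList] at hi
        simp only [Set.mem_Iio]
        omega)]
  have h1 := sweep_range'_of_le (m := m) (p := 0) (c := k-1+1-1) (by omega) f
    (fun j _ _ => hf j (by omega))
  change ∀ j, sweep m f (ascList 1 (k-1)) j = _ at h1
  generalize sweep m f (ascList 1 (k-1)) = f₁ at *
  have hs : ∀ (f : ℕ → ℕ) j, windowStepK m k f k j =
      if j = k-1 then f k else if j = k then f (k-1) else f j := by
    intro f j
    rw [windowStepK, if_pos rfl]
  have h1' : ∀ j, windowStepK m k f₁ k j = if j < k-1 then f (j+1) else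
      if j = k-1 then f k else if j = k then f 0 else f j := by
    intro j
    simp only [hs, h1]
    split_ifs <;> omega
  generalize windowStepK m k f₁ k = f₂ at *
  have h2 := isGreatest_sweep_reflWord hkm f₂
  have h3 := fun j hj => sweep_reflWord_of_lt (m := m) (k := k) (j := j) hj f₂
  generalize sweep m f₂ (reflWord m k) = g at *
  have hset : symRange m f₂ k = symRange m f (k+1) ∪ {f 0, 2*m+1 - f 0} := by
    ext x
    simp only [symRange, Set.mem_union, Set.mem_ofPred_eq, Set.mem_insert_iff,
      Set.mem_singleton_iff]
    constructor
    · rintro ⟨j, hj1, hj2, hx⟩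
      rw [h1', if_neg (by omega), if_neg (by omega)] at hx
      split_ifs at hx with h
      · exact Or.inr hx
      · exact Or.inl ⟨j, by omega, hj2, hx⟩
    · rintro (⟨j, hj1, hj2, hx⟩ | hx)
      · refine ⟨j, by omega, hj2, ?_⟩
        rwa [h1', if_neg (by omega), if_neg (by omega), if_neg (by omega)]
      · refine ⟨k, le_rfl, hkm, ?_⟩
        rwa [h1', if_neg (by omega), if_neg (by omega), if_pos rfl]
  rw [hset] at h2
  refine ⟨_, h2, image_Iio_eq hk (fun j hj => ?_) ?_⟩
  · rw [hs, if_neg (by omega), if_neg (by omega), h3 j (by omega), h1', if_pos hj]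
  · rw [hs, if_pos rfl]

lemma sweep_wordOZ_one {m k : ℕ} (hk : 2 ≤ k) (hkm : k ≤ m) (f : ℕ → ℕ)
    (hf : ∀ j, 1 ≤ j → j < k → f 1 ≤ f j) :
    ∃ X, IsGreatest (symRange m f k ∪ {f 1, 2*m+1 - f 1}) X ∧
      sweep m f (wordOZ m 1) '' Set.Iio k = insert (f 0) (f '' Set.Ico 2 k ∪ {X}) := by
  rw [wordOZ_one_eq hk hkm, sweep_append, sweep_append, sweep_append, sweep_append,
    sweep_singleton, sweep_singleton,
    sweep_image (S := Set.Iio k) (ascList 2 (k-1)).reverse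
      (fun i hi => by
        rw [List.mem_reverse, mem_ascList] at hi
        simp only [Set.mem_Iio]
        omega)]
  have h1 := sweep_range'_of_le (m := m) (p := 1) (c := k-1+1-2) (by omega) f
    (fun j hj _ => hf j hj (by omega))
  change ∀ j, sweep m f (ascList 2 (k-1)) j = _ at h1
  generalize sweep m f (ascList 2 (k-1)) = f₁ at *
  have hs : ∀ (f : ℕ → ℕ) j, windowStep m f k j =
      if j = k-1 then max (f (k-1)) (f k) else if j = k then min (f (k-1)) (f k) else f j := by
    intro f j
    rw [windowStep, if_pos hkm]
  have h1' : ∀ j, windowStep m f₁ k j = if 1 ≤ j ∧ j < k-1 then f (j+1) else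
      if j = k-1 then max (f 1) (f k) else if j = k then min (f 1) (f k) else f j := by
    intro j
    simp only [hs, h1]
    split_ifs <;> omega
  generalize windowStep m f₁ k = f₂ at *
  have h2 := isGreatest_sweep_reflWord hkm f₂
  have h3 := fun j hj => sweep_reflWord_of_lt (m := m) (k := k) (j := j) hj f₂
  generalize sweep m f₂ (reflWord m k) = g at *
  have hfk : f₂ k = min (f 1) (f k) := by
    rw [h1', if_neg (by omega), if_neg (by omega), if_pos rfl]
  have hgk : g (k-1) = max (f 1) (f k) := by
    rw [h3 _ (by omega), h1', if_neg (by omega), if_pos rfl]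
  refine ⟨max (f 1) (max (f k) (g k)), ⟨?_, ?_⟩, ?_⟩
  · obtain ⟨j, hj1, hj2, hx⟩ := h2.1
    have hgk' : g k ∈ symRange m f k ∪ {f 1, 2*m+1 - f 1} := by
      by_cases hjk : j = k
      · subst hjk
        rw [hfk] at hx
        rcases le_total (f 1) (f j) with h | h
        · rw [min_eq_left h] at hx
          exact Or.inr hx
        · rw [min_eq_right h] at hx
          exact Or.inl ⟨j, hj1, hj2, hx⟩
      · rw [h1', if_neg (by omega), if_neg (by omega), if_neg hjk] at hx
        exact Or.inl ⟨j, hj1, hj2, hx⟩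
    have hfk' : f k ∈ symRange m f k ∪ {f 1, 2*m+1 - f 1} :=
      Or.inl ⟨k, le_rfl, hkm, Or.inl rfl⟩
    have hf1 : f 1 ∈ symRange m f k ∪ {f 1, 2*m+1 - f 1} := Or.inr (Or.inl rfl)
    rcases max_choice (f k) (g k) with h | h <;> rw [h]
    · rcases max_choice (f 1) (f k) with h | h <;> rw [h] <;> assumption
    · rcases max_choice (f 1) (g k) with h | h <;> rw [h] <;> assumption
  · have hb : 2*m+1 - min (f 1) (f k) ≤ g k :=
      h2.2 ⟨k, le_rfl, hkm, Or.inr (by rw [hfk])⟩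
    rintro x (⟨j, hj1, hj2, hx⟩ | hx)
    · by_cases hjk : j = k
      · subst hjk
        omega
      · have : x ≤ g k := h2.2 ⟨j, hj1, hj2, by
          rwa [h1', if_neg (by omega), if_neg (by omega), if_neg hjk]⟩
        omega
    · rcases hx with rfl | hx
      · omega
      · rw [Set.mem_singleton_iff] at hx
        omega
  · ext x
    simp only [Set.mem_image, Set.mem_Iio, Set.mem_insert_iff, Set.mem_union, Set.mem_Ico,
      Set.mem_singleton_iff]
    constructor
    · rintro ⟨j, hj, rfl⟩
      rw [hs]
      by_cases hjk : j = k-1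
      · rw [if_pos hjk, hgk]
        exact Or.inr (Or.inr (max_assoc _ _ _))
      · rw [if_neg hjk, if_neg (by omega), h3 j hj, h1']
        by_cases hj0 : j = 0
        · subst hj0
          rw [if_neg (by omega), if_neg hjk, if_neg (by omega)]
          exact Or.inl rfl
        · rw [if_pos (by omega)]
          exact Or.inr (Or.inl ⟨j+1, by omega, rfl⟩)
    · rintro (rfl | ⟨j, hj, rfl⟩ | rfl)
      · refine ⟨0, by omega, ?_⟩
        rw [hs, if_neg (by omega), if_neg (by omega), h3 _ (by omega), h1', if_neg (by omega),
          if_neg (by omega), if_neg (by omega)]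
      · refine ⟨j-1, by omega, ?_⟩
        rw [hs, if_neg (by omega), if_neg (by omega), h3 _ (by omega), h1', if_pos (by omega),
          show j - 1 + 1 = j by omega]
      · refine ⟨k-1, by omega, ?_⟩
        rw [hs, if_pos rfl, hgk, max_assoc]


/-! ### Sorted windows -/

/-- `f` is the window of a minimal length coset representative: its values represent every pair
`{x, 2m+1-x}` exactly once, and it increases on `[0,k)` and on `[k,m]`, with unbarred values on
the latter. -/
structure SortedWindow (m k : ℕ) (f : ℕ → ℕ) : Prop where
  strictMonoOn_lo : ∀ i j, i < j → j < k → f i < f j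
  strictMonoOn_hi : ∀ i j, k ≤ i → i < j → j ≤ m → f i < f j
  le_of_ge : ∀ j, k ≤ j → j ≤ m → f j ≤ m
  le : ∀ j, j ≤ m → f j ≤ 2*m+1
  inj : ∀ i j, i ≤ m → j ≤ m → f i = f j → i = j
  add_ne : ∀ i j, i ≤ m → j ≤ m → f i + f j ≠ 2*m+1
  exists_eq : ∀ x, x ≤ 2*m+1 → ∃ j, j ≤ m ∧ (f j = x ∨ f j + x = 2*m+1)

lemma isMinRep.sortedWindow {m k : ℕ} (hkm : k ≤ m) {w : Equiv.Perm (Fin (2*m+2))}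
    (hw : isMinRep m k w) : SortedWindow m k (window m w) := by
  have hstep : ∀ i, i + 1 ≤ m → i + 1 ≠ k → window m w i < window m w (i+1) := by
    intro i hi hik
    rw [window_of_le (by omega), window_of_le hi]
    exact hw.lt (i := i+1) (by omega) (by omega) hik
  have hchain : ∀ i d, i + d + 1 ≤ m → (i + d + 1 < k ∨ k ≤ i) →
      window m w i < window m w (i+d+1) := by
    intro i d
    induction d with
    | zero => exact fun h1 h2 => hstep i h1 (by omega)
    | succ d ih =>
      exact fun h1 h2 => (ih (by omega) (by omega)).trans (hstep _ h1 (by omega))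
  have hhi : ∀ i j, k ≤ i → i < j → j ≤ m → window m w i < window m w j := by
    intro i j h1 h2 h3
    obtain ⟨d, rfl⟩ := Nat.exists_eq_add_of_lt h2
    exact hchain i d h3 (Or.inr h1)
  have hne : ∀ i j, i < 2*m+2 → j < 2*m+2 → (w (fn m i) : ℕ) = w (fn m j) → i = j := by
    intro i j hi hj h
    rw [← fn_val hi, w.injective (Fin.ext h), fn_val hj]
  refine ⟨?_, hhi, ?_, ?_, ?_, ?_, ?_⟩
  · intro i j h1 h2
    obtain ⟨d, rfl⟩ := Nat.exists_eq_add_of_lt h1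
    exact hchain i d (by omega) (Or.inl h2)
  · intro j h1 h2
    have h3 : window m w j ≤ window m w m := by
      rcases h2.eq_or_lt with rfl | h2
      · rfl
      · exact (hhi j m h1 h2 le_rfl).le
    have h4 := hw.lt (i := m+1) (by omega) le_rfl (by omega)
    have h5 := Weyl_apply_fn hw.1 (j := m) (by omega)
    rw [show 2*m+1-m = m+1 by omega] at h5
    rw [Fin.lt_def, Nat.add_sub_cancel] at h4
    rw [window_of_le (le_refl m)] at h3
    omega
  · intro j hj
    rw [window_of_le hj]
    have := (w (fn m j)).isLt
    omega
  · intro i j hi hj h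
    rw [window_of_le hi, window_of_le hj] at h
    exact hne i j (by omega) (by omega) h
  · intro i j hi hj h
    rw [window_of_le hi, window_of_le hj] at h
    have h1 := Weyl_apply_fn hw.1 (j := j) (by omega)
    have := hne i (2*m+1-j) (by omega) (by omega) (by omega)
    omega
  · intro x hx
    have h1 : w (fn m (w⁻¹ (fn m x) : Fin _)) = fn m x := by rw [fn_coe, perm_apply_inv]
    have h2 := (w⁻¹ (fn m x)).isLt
    generalize ((w⁻¹ (fn m x) : Fin _) : ℕ) = j at h1 h2
    have h3 : (w (fn m j) : ℕ) = x := by rw [h1, fn_val (by omega)]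
    rcases Nat.lt_or_ge m j with hm | hm
    · refine ⟨2*m+1-j, by omega, Or.inr ?_⟩
      rw [window_of_le (by omega), Weyl_apply_fn hw.1 h2]
      omega
    · exact ⟨j, hm, Or.inl (by rw [window_of_le hm, h3])⟩

namespace SortedWindow

variable {m k : ℕ} {f : ℕ → ℕ}

lemma mem_symRange (hf : SortedWindow m k f) {x : ℕ} : x ∈ symRange m f k ↔
    x ≤ 2*m+1 ∧ x ∉ f '' Set.Iio k ∧ 2*m+1-x ∉ f '' Set.Iio k := by
  constructor
  · rintro ⟨j, hkj, hjm, hx⟩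
    have h1 := hf.le j hjm
    refine ⟨by omega, ?_, ?_⟩
    all_goals
      rintro ⟨i, hi, h⟩
      rw [Set.mem_Iio] at hi
      have h2 := hf.add_ne i j (by omega) hjm
      have h3 := hf.inj i j (by omega) hjm
      rcases hx with rfl | rfl <;> omega
  · rintro ⟨hx, h1, h2⟩
    obtain ⟨j, hj, h⟩ := hf.exists_eq x hx
    have hkj : k ≤ j := by
      by_contra! hjk
      rcases h with h | h
      · exact h1 ⟨j, hjk, h⟩
      · exact h2 ⟨j, hjk, by omega⟩
    have := hf.le j hj
    exact ⟨j, hkj, hj, by omega⟩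

lemma isLeast (hf : SortedWindow m k f) (hk : 1 ≤ k) : IsLeast (f '' Set.Iio k) (f 0) := by
  refine ⟨⟨0, hk, rfl⟩, ?_⟩
  rintro _ ⟨j, hj, rfl⟩
  rcases Nat.eq_zero_or_pos j with rfl | h
  · rfl
  · exact (hf.strictMonoOn_lo 0 j h hj).le

lemma image_Ico_one (hf : SortedWindow m k f) :
    f '' Set.Ico 1 k = f '' Set.Iio k \ {f 0} := by
  ext x
  constructor
  · rintro ⟨j, ⟨h1, h2⟩, rfl⟩
    exact ⟨⟨j, h2, rfl⟩, (hf.strictMonoOn_lo 0 j h1 h2).ne'⟩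
  · rintro ⟨⟨j, h2, rfl⟩, h⟩
    refine ⟨j, ⟨Nat.one_le_iff_ne_zero.2 ?_, h2⟩, rfl⟩
    rintro rfl
    exact h rfl

lemma apply_eq_zero (hf : SortedWindow m k f) (h0 : 0 ∉ f '' Set.Iio k)
    (hN : 2*m+1 ∉ f '' Set.Iio k) : f k = 0 := by
  obtain ⟨j, hkj, hj, h⟩ := hf.mem_symRange.2 ⟨Nat.zero_le _, h0, hN⟩
  have h1 := hf.le_of_ge j hkj hj
  rcases hkj.eq_or_lt with rfl | h2
  · omega
  · have := hf.strictMonoOn_hi k j le_rfl h2 hj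
    omega

lemma mem_symRange_succ (hf : SortedWindow m k f) (hkm : k ≤ m) {x : ℕ} :
    x ∈ symRange m f (k+1) ↔ x ∈ symRange m f k ∧ x ≠ f k ∧ x ≠ 2*m+1 - f k := by
  constructor
  · rintro ⟨j, hkj, hjm, hx⟩
    refine ⟨⟨j, by omega, hjm, hx⟩, ?_⟩
    have h1 := hf.le j hjm
    have h2 := hf.add_ne j k hjm hkm
    have h3 := hf.inj j k hjm hkm
    have h4 := hf.le k hkm
    omega
  · rintro ⟨⟨j, hkj, hjm, hx⟩, h1, h2⟩
    refine ⟨j, Nat.lt_of_le_of_ne hkj ?_, hjm, hx⟩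
    rintro rfl
    omega

end SortedWindow

/-- The square property at the level of windows, for `k = 1`. -/
lemma image_sweep_eq_of_eq_one {m : ℕ} (hm : 1 ≤ m) {f g₁ g₂ : ℕ → ℕ} (hf : SortedWindow m 1 f)
    (h₁ : SortedWindow m 1 g₁) (h₂ : SortedWindow m 1 g₂) (hf0 : f 0 = 0)
    (e₁ : g₁ '' Set.Iio 1 = sweep m f (wordOZ m 1) '' Set.Iio 1)
    (e₂ : g₂ '' Set.Iio 1 = sweep m f (wordOY1 m 1) '' Set.Iio 1) :
    sweep m g₁ (wordOY1 m 1) '' Set.Iio 1 = sweepK m 1 g₂ (wordOcirc m 1) '' Set.Iio 1 := by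
  have hI : ∀ g : ℕ → ℕ, g '' Set.Iio 1 = {g 0} := by
    intro g
    rw [show Set.Iio 1 = {0} by ext; simp, Set.image_singleton]
  have hE : ∀ g : ℕ → ℕ, g '' Set.Ico 1 1 = ∅ := by simp
  have hg₁ : g₁ 0 = 0 := by
    rw [hI, hI, wordOZ_one_eq_reflWord, sweep_reflWord_of_lt one_pos, hf0] at e₁
    exact Set.singleton_injective e₁
  obtain ⟨c, hc, ec⟩ := sweep_wordOY1 le_rfl hm f hf0
  obtain ⟨P, hP, eP⟩ := sweep_wordOY1 le_rfl hm g₁ hg₁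
  obtain ⟨Y, hY, eY⟩ := sweepK_wordOcirc_one le_rfl hm g₂
    (fun j hj => by rw [Nat.lt_one_iff.1 hj])
  rw [hE, Set.empty_union] at ec eP eY
  rw [ec, hI] at e₂
  have hg₂ : g₂ 0 = c := Set.singleton_injective e₂
  rw [eP, eY]
  have hsym : ∀ g : ℕ → ℕ, SortedWindow m 1 g → ∀ x, x ∈ symRange m g 1 ↔
      x ≤ 2*m+1 ∧ x ≠ g 0 ∧ 2*m+1-x ≠ g 0 := by
    intro g hg x
    rw [hg.mem_symRange, hI]
    rfl
  have hcm := (hsym f hf c).1 hc.1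
  have hgk : g₂ 1 = 0 := by
    apply h₂.apply_eq_zero <;> rw [hI, Set.mem_singleton_iff] <;> omega
  have hPc : P = c := by
    have hs : symRange m g₁ 1 = symRange m f 1 := by
      ext x
      rw [hsym g₁ h₁, hsym f hf, hg₁, hf0]
    exact (hs ▸ hP).unique hc
  have hYc : Y = c := by
    have hs : symRange m g₂ (1+1) ∪ {g₂ 0, 2*m+1 - g₂ 0} = symRange m f 1 := by
      ext x
      rw [Set.mem_union, Set.mem_insert_iff, Set.mem_singleton_iff, h₂.mem_symRange_succ hm,
        hsym g₂ h₂, hsym f hf]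
      omega
    exact (hs ▸ hY).unique hc
  rw [hPc, hYc]

/-- The square property at the level of windows, for `2 ≤ k`. -/
lemma image_sweep_eq_of_two_le {m k : ℕ} (hk : 2 ≤ k) (hkm : k ≤ m) {f g₁ g₂ : ℕ → ℕ}
    (hf : SortedWindow m k f)
    (h₁ : SortedWindow m k g₁) (h₂ : SortedWindow m k g₂) (hf0 : f 0 = 0)
    (e₁ : g₁ '' Set.Iio k = sweep m f (wordOZ m 1) '' Set.Iio k)
    (e₂ : g₂ '' Set.Iio k = sweep m f (wordOY1 m k) '' Set.Iio k) :
    sweep m g₁ (wordOY1 m k) '' Set.Iio k = sweepK m k g₂ (wordOcirc m 1) '' Set.Iio k := by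
  have hk1 : 1 ≤ k := by omega
  obtain ⟨X, hX, eX⟩ := sweep_wordOZ_one hk hkm f (fun j hj hjk => by
    rcases hj.eq_or_lt with rfl | hj
    · rfl
    · exact (hf.strictMonoOn_lo 1 j hj hjk).le)
  obtain ⟨c, hc, ec⟩ := sweep_wordOY1 hk1 hkm f hf0
  obtain ⟨Y, hY, eY⟩ := sweepK_wordOcirc_one hk1 hkm g₂
    (fun j hj => (h₂.isLeast hk1).2 ⟨j, hj, rfl⟩)
  set a := f 1 with ha
  set R := f '' Set.Ico 2 k with hR
  have hI1 : f '' Set.Ico 1 k = insert a R := by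
    rw [hR, ha, ← Set.image_insert_eq]
    congr 1
    ext j
    simp only [Set.mem_Ico, Set.mem_insert_iff]
    omega
  have hI0 : f '' Set.Iio k = insert 0 (insert a R) := by
    rw [← hI1, ← hf0, ← Set.image_insert_eq]
    congr 1
    ext j
    simp only [Set.mem_Ico, Set.mem_insert_iff, Set.mem_Iio]
    omega
  have hRa : ∀ x ∈ R, a < x ∧ x < 2*m+1 ∧ x + a ≠ 2*m+1 := by
    rintro _ ⟨j, ⟨h1, h2⟩, rfl⟩
    have h3 := hf.add_ne 0 j (by omega) (by omega)
    have h4 := hf.add_ne j 1 (by omega) (by omega)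
    have h5 := hf.le j (by omega)
    exact ⟨hf.strictMonoOn_lo 1 j (by omega) h2, by omega, h4⟩
  have ha0 : 0 < a := hf0 ▸ hf.strictMonoOn_lo 0 1 one_pos (by omega)
  have haN : a < 2*m+1 := by
    have h3 := hf.add_ne 0 1 (by omega) (by omega)
    have h5 := hf.le 1 (by omega)
    omega
  rw [eX, hf0] at e₁
  rw [ec, hI1] at e₂
  clear_value a R
  have hB : ∀ x, x ∈ symRange m f k ↔ x ≤ 2*m+1 ∧ (x ≠ 0 ∧ x ≠ a ∧ x ∉ R) ∧
      (2*m+1-x ≠ 0 ∧ 2*m+1-x ≠ a ∧ 2*m+1-x ∉ R) := by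
    intro x
    rw [hf.mem_symRange, hI0]
    simp only [Set.mem_insert_iff, not_or, ne_eq]
  have hX0 : X ≠ 0 ∧ X < 2*m+1 := by
    have := hX.1
    simp only [Set.mem_union, Set.mem_insert_iff, Set.mem_singleton_iff, hB] at this
    omega
  have hR0 : 0 ∉ R := fun h => by have := hRa 0 h; omega
  have hRN : 2*m+1 ∉ R := fun h => by have := hRa _ h; omega
  have hcB := (hB c).1 hc.1
  have hg₁ : g₁ 0 = 0 := Nat.le_zero.1 ((h₁.isLeast hk1).2 (by rw [e₁]; simp))
  obtain ⟨P, hP, eP⟩ := sweep_wordOY1 hk1 hkm g₁ hg₁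
  have hg₂ : g₂ 0 = min a c := by
    refine (h₂.isLeast hk1).unique ?_
    rw [e₂]
    constructor
    · rcases min_choice a c with h | h <;> rw [h] <;> simp
    · rintro x ((rfl | hx) | rfl)
      · exact min_le_left _ _
      · exact (min_le_left _ _).trans (hRa x hx).1.le
      · exact min_le_right _ _
  have hgk : g₂ k = 0 := by
    apply h₂.apply_eq_zero <;> rw [e₂] <;>
      simp only [Set.mem_union, Set.mem_insert_iff, Set.mem_singleton_iff, not_or]
    · exact ⟨⟨by omega, hR0⟩, by omega⟩
    · exact ⟨⟨by omega, hRN⟩, by omega⟩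
  have hS₁ : ∀ x, x ∈ symRange m g₁ k ↔
      (x ∈ symRange m f k ∪ {a, 2*m+1-a}) ∧ x ≠ X ∧ x ≠ 2*m+1-X := by
    intro x
    rw [h₁.mem_symRange, e₁]
    simp only [Set.mem_union, Set.mem_insert_iff, Set.mem_singleton_iff, not_or, hB]
    by_cases p : x ∈ R
    · have := hRa x p
      simp only [p, not_true_eq_false, false_and, and_false, false_or, false_iff]
      omega
    by_cases q : 2*m+1-x ∈ R
    · have := hRa _ q
      simp only [q, not_true_eq_false, false_and, and_false, false_or, false_iff]
      omega
    simp only [p, q, not_false_eq_true, true_and, and_true]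
    omega
  have hS₂ : ∀ x, x ∈ symRange m g₂ (k+1) ↔ x ∈ symRange m f k ∧ x ≠ c ∧ x ≠ 2*m+1-c := by
    intro x
    rw [h₂.mem_symRange_succ hkm, h₂.mem_symRange, e₂, hgk]
    simp only [Set.mem_union, Set.mem_insert_iff, Set.mem_singleton_iff, not_or, hB]
    by_cases p : x ∈ R
    · simp only [p, not_true_eq_false, false_and, and_false]
    by_cases q : 2*m+1-x ∈ R
    · simp only [q, not_true_eq_false, false_and, and_false]
    simp only [p, q, not_false_eq_true, and_true]
    omega
  rw [eP, eY, h₁.image_Ico_one, h₂.image_Ico_one, hg₁, hg₂, e₁, e₂]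
  have hcc : 2*m+1-c ≤ c := hc.2 ((hB _).2 (by
    rw [show 2*m+1-(2*m+1-c) = c by omega]
    exact ⟨by omega, hcB.2.2, hcB.2.1⟩))
  have hX₁ : a ≤ X ∧ 2*m+1-a ≤ X ∧ c ≤ X :=
    ⟨hX.2 (Or.inr (Or.inl rfl)), hX.2 (Or.inr (Or.inr rfl)), hX.2 (Or.inl hc.1)⟩
  have hX₂ : X ≤ c ∨ X = a ∨ X = 2*m+1-a := hX.1.imp_left fun h => hc.2 h
  have hP₁ : c ≠ X → c ≠ 2*m+1-X → c ≤ P := fun h h' => hP.2 ((hS₁ c).2 ⟨Or.inl hc.1, h, h'⟩)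
  obtain ⟨hPm, hP₂, hP₃⟩ := (hS₁ P).1 hP.1
  have hP₄ : P ≤ c ∨ P = a ∨ P = 2*m+1-a := hPm.imp_left fun h => hc.2 h
  have hY₁ : min a c ≤ Y ∧ 2*m+1 - min a c ≤ Y :=
    hg₂ ▸ ⟨hY.2 (Or.inr (Or.inl rfl)), hY.2 (Or.inr (Or.inr rfl))⟩
  have hYm := hY.1
  rw [hg₂, Set.mem_union, hS₂] at hYm
  have hY₂ : Y ≤ c ∨ Y = min a c ∨ Y = 2*m+1 - min a c := hYm.imp_left fun h => hc.2 h.1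
  have key : X = max a c ∧ P = Y ∨ X = Y ∧ P = max a c := by
    rcases Nat.lt_or_gt_of_ne hcB.2.1.2.1 with hca | hac
    · rw [min_eq_right hca.le] at hY₁ hY₂
      have hXa : X = a := by omega
      refine Or.inl ⟨by rw [max_eq_left hca.le, hXa], ?_⟩
      have := hP₁ (by omega) (by omega)
      omega
    by_cases hXc : X = c
    · refine Or.inl ⟨by omega, le_antisymm ?_ ?_⟩
      · rcases hPm with h | h
        · exact hY.2 (Or.inl ((hS₂ P).2 ⟨h, hXc ▸ hP₂, hXc ▸ hP₃⟩))
        · refine hY.2 (Or.inr ?_)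
          rwa [hg₂, min_eq_left hac.le]
      · apply hP.2
        rw [hS₁, hXc]
        rw [min_eq_left hac.le] at hYm
        rcases hYm with h | h
        · exact ⟨Or.inl h.1, h.2⟩
        · refine ⟨Or.inr h, ?_⟩
          rw [Set.mem_insert_iff, Set.mem_singleton_iff] at h
          omega
    · rw [min_eq_left hac.le] at hY₁ hY₂
      have hXa : X = 2*m+1-a := by omega
      refine Or.inr ⟨by omega, ?_⟩
      rw [max_eq_right hac.le]
      have := hP₁ (by omega) (by omega)
      omega
  have hL : insert 0 (R ∪ {X}) \ {0} = R ∪ {X} := by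
    refine Set.insert_sdiff_self_of_notMem ?_
    rintro (h | h)
    · exact hR0 h
    · exact hX0.1 h.symm
  have hM : (insert a R ∪ {c}) \ {min a c} = R ∪ {max a c} := by
    have h₁ : a ∉ R := fun h => (hRa a h).1.false
    have h₂ : c ∉ R := hcB.2.1.2.2
    rcases Nat.lt_or_gt_of_ne hcB.2.1.2.1 with h | h
    · rw [min_eq_right h.le, max_eq_left h.le, Set.union_singleton, Set.union_singleton]
      refine Set.insert_sdiff_self_of_notMem ?_
      rintro (h' | h')
      · exact h.ne h'
      · exact h₂ h'
    · rw [min_eq_left h.le, max_eq_right h.le, Set.insert_union]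
      refine Set.insert_sdiff_self_of_notMem ?_
      rintro (h' | h')
      · exact h₁ h'
      · exact h.ne h'
  rw [hL, hM]
  rcases key with ⟨h, h'⟩ | ⟨h, h'⟩
  · rw [h, h']
  · rw [h, h', Set.union_assoc, Set.union_assoc, Set.union_comm {Y}]

lemma image_sweep_eq {m k : ℕ} (hk : 1 ≤ k) (hkm : k ≤ m) {f g₁ g₂ : ℕ → ℕ}
    (hf : SortedWindow m k f)
    (h₁ : SortedWindow m k g₁) (h₂ : SortedWindow m k g₂) (hf0 : f 0 = 0)
    (e₁ : g₁ '' Set.Iio k = sweep m f (wordOZ m 1) '' Set.Iio k)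
    (e₂ : g₂ '' Set.Iio k = sweep m f (wordOY1 m k) '' Set.Iio k) :
    sweep m g₁ (wordOY1 m k) '' Set.Iio k = sweepK m k g₂ (wordOcirc m 1) '' Set.Iio k := by
  rcases hk.eq_or_lt with rfl | hk
  · exact image_sweep_eq_of_eq_one hkm hf h₁ h₂ hf0 e₁ e₂
  · exact image_sweep_eq_of_two_le hk hkm hf h₁ h₂ hf0 e₁ e₂

/-- The "square" property: for `w ∈ W^{odd} ∩ W^P` with `w(1) = 1`,
`((w · O_Z(1)) W_P · O_Y(1)) W_P = ((w · O_Y(1)) W_P ·_k O^∘(1)) W_P`, where the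
intermediate cosets are represented by their minimal length representatives `u1, u2`. -/
theorem statement7 (n k : ℕ) (hn : 1 ≤ n) (hk : 1 ≤ k) (hk' : k < n+1)
    (w : Equiv.Perm (Fin (2*n+2))) (hw : isMinRep n k w) (hwodd : isOdd n w)
    (hw1 : w (fn n 0) = fn n 0)
    (u1 : Equiv.Perm (Fin (2*n+2))) (hu1 : isMinRep n k u1)
    (hu1c : cosetEq n k u1 (mulOZ n w 1))
    (u2 : Equiv.Perm (Fin (2*n+2))) (hu2 : isMinRep n k u2)
    (hu2c : cosetEq n k u2 (mulOY1 n k w)) :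
    cosetEq n k (mulOY1 n k u1) (mulOcirc n k u2 1) := by
  have hkn : k ≤ n := by omega
  obtain ⟨zW, zE⟩ := window_hWord (wordOZ n 1) (fun _ => mem_wordOZ_one) hw.1
  obtain ⟨yW, yE⟩ := window_hWord (wordOY1 n k) (fun _ => mem_wordOY1 hk hkn) hw.1
  obtain ⟨lW, lE⟩ := window_hWord (wordOY1 n k) (fun _ => mem_wordOY1 hk hkn) hu1.1
  obtain ⟨rW, rE⟩ := window_hWordK hkn (wordOcirc n 1) (fun _ => mem_wordOcirc_one) hu2.1
  rw [mulOZ, cosetEq_iff_window hkn hu1.1 zW, zE] at hu1c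
  rw [mulOY1, cosetEq_iff_window hkn hu2.1 yW, yE] at hu2c
  rw [mulOY1, mulOcirc, cosetEq_iff_window hkn lW rW, lE, rE]
  exact image_sweep_eq hk hkn (hw.sortedWindow hkn) (hu1.sortedWindow hkn) (hu2.sortedWindow hkn)
    (by rw [window_of_le (Nat.zero_le n), hw1, fn_val (by omega)]) hu1c hu2c

end
end OddSymplectic
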